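/- arXiv:1804.07109 — 2 statements merged into one kernel-verified Lean document; each statement's English description precedes it below -/
import Mathlib

section
/- Let K₃ be the subfield of ℂ generated over ℚ by ζ₈ = exp(2πi/8) and by √−7 = i·√7. Then the set {(x, y) ∈ K₃ × K₃ | x⁴ + y⁴ = 1} has exactly 104 elements. -/
open Complex Real

theorem fq_descent : ∀ (N : ℕ) (p q r : ℤ), r.natAbs = N → p ≠ 0 → q ≠ 0 →
    p ^ 4 + 4 * q ^ 4 = r ^ 2 → False := by
  intro N
  induction N using Nat.strong_induction_on with
  | _ N ih =>
  intro p q r hr hp hq h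
  have hr0 : r ≠ 0 := by
    rintro rfl
    have : 0 < p ^ 4 := by positivity
    have : 0 < q ^ 4 := by positivity
    nlinarith
  by_cases hco : Int.gcd p q = 1
  swap
  · obtain ⟨d, hd, hdd⟩ := Nat.exists_prime_and_dvd hco
    obtain ⟨p', rfl⟩ := (Int.natCast_dvd_natCast.mpr hdd).trans (Int.gcd_dvd_left ..)
    obtain ⟨q', rfl⟩ := (Int.natCast_dvd_natCast.mpr hdd).trans (Int.gcd_dvd_right ..)
    have hd0 : (d : ℤ) ≠ 0 := by exact_mod_cast hd.ne_zero
    have : (d : ℤ) ^ 2 ∣ r := by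
      rw [← Int.pow_dvd_pow_iff (n := 2) two_ne_zero]
      exact ⟨p' ^ 4 + 4 * q' ^ 4, by rw [← h]; ring⟩
    obtain ⟨r', rfl⟩ := this
    have hr' : r' ≠ 0 := by rintro rfl; simp at hr0
    refine ih r'.natAbs ?_ p' q' r' rfl (right_ne_zero_of_mul hp) (right_ne_zero_of_mul hq) ?_
    · rw [← hr, Int.natAbs_mul, Int.natAbs_pow, Int.natAbs_natCast]
      have : 1 ≤ r'.natAbs := Int.natAbs_pos.mpr hr'
      have h4 : 2 ≤ d ^ 2 := by have := hd.two_le; nlinarith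
      nlinarith
    · have : (d : ℤ) ^ 4 * (p' ^ 4 + 4 * q' ^ 4) = d ^ 4 * r' ^ 2 := by linear_combination h
      exact mul_left_cancel₀ (by positivity) this
  rcases Int.emod_two_eq_zero_or_one p with hpar | hpar
  · obtain ⟨p', rfl⟩ := Int.dvd_of_emod_eq_zero hpar
    have : (2 : ℤ) ∣ r := by
      rw [← Int.pow_dvd_pow_iff (n := 2) two_ne_zero]
      exact ⟨4 * p' ^ 4 + q ^ 4, by rw [← h]; ring⟩
    obtain ⟨r', rfl⟩ := this
    have hr' : r' ≠ 0 := by rintro rfl; simp at hr0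
    refine ih r'.natAbs ?_ q p' r' rfl hq (right_ne_zero_of_mul hp) ?_
    · rw [← hr, Int.natAbs_mul]
      have : 1 ≤ r'.natAbs := Int.natAbs_pos.mpr hr'
      simp; omega
    · linarith
  · have key : ∀ r : ℤ, 0 < r → r.natAbs = N → p ^ 4 + 4 * q ^ 4 = r ^ 2 → False := by
      clear h hr hr0 r
      intro r hr0 hr h
      have hco2 : Int.gcd (p ^ 2) (2 * q ^ 2) = 1 := by
        rw [← Int.isCoprime_iff_gcd_eq_one] at hco ⊢
        apply IsCoprime.pow_left
        apply IsCoprime.mul_right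
        · exact ⟨1, -(p / 2), by omega⟩
        · exact hco.pow_right
      obtain ⟨m, n, h1, h2, h3, h4, h5, h6⟩ :=
        PythagoreanTriple.coprime_classification' (x := p ^ 2) (y := 2 * q ^ 2) (z := r)
          (by unfold PythagoreanTriple; linear_combination h) hco2
          (by rw [pow_two, Int.mul_emod, hpar]; rfl) hr0
      have hmn : m * n = q ^ 2 := by linarith
      have hq2 : 0 < q ^ 2 := by positivity
      have hm : 0 < m := by
        rcases h6.lt_or_eq with h | h
        · exact h
        · rw [← h] at hmn; rw [← hmn] at hq2; simp at hq2
      have hn : 0 < n := by nlinarith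
      obtain ⟨u, hu⟩ : ∃ u, m = u ^ 2 := by
        obtain ⟨u, hu | hu⟩ := Int.sq_of_gcd_eq_one h4 hmn
        · exact ⟨u, hu⟩
        · nlinarith [sq_nonneg u]
      obtain ⟨v, hv⟩ : ∃ v, n = v ^ 2 := by
        obtain ⟨u, hu | hu⟩ := Int.sq_of_gcd_eq_one ((Int.gcd_comm _ _).trans h4) ((mul_comm _ _).trans hmn)
        · exact ⟨u, hu⟩
        · nlinarith [sq_nonneg u]
      have hpn : Int.gcd p n = 1 := by
        rw [← Int.isCoprime_iff_gcd_eq_one] at h4 ⊢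
        have : IsCoprime (p ^ 2) n := by
          rw [h1]
          have := (h4.pow_left (m := 2)).add_mul_left_left (-n)
          have e : m ^ 2 - n ^ 2 = m ^ 2 + n * -n := by ring
          rwa [e]
        exact (IsCoprime.pow_left_iff two_pos).mp this
      obtain ⟨g, k, k1, k2, k3, k4, k5, k6⟩ :=
        PythagoreanTriple.coprime_classification' (x := p) (y := n) (z := m)
          (by unfold PythagoreanTriple; linear_combination h1) hpn hpar hm
      have hg : 0 < g := by
        rcases k6.lt_or_eq with h | h
        · exact h
        · rw [← h] at k2; simp at k2; omega
      have hk : 0 < k := by nlinarith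
      have fin : ∀ g k : ℤ, 0 < g → 0 < k → Int.gcd g k = 1 → n = 2 * g * k → m = g ^ 2 + k ^ 2 →
          g % 2 = 0 → False := by
        clear k1 k2 k3 k4 k5 k6 hg hk g k
        intro g k hg hk k4 k2 k3 k5
        obtain ⟨g', rfl⟩ := Int.dvd_of_emod_eq_zero k5
        have : (2 : ℤ) ∣ v := by
          rw [← Int.pow_dvd_pow_iff (n := 2) two_ne_zero]
          exact ⟨g' * k, by rw [← hv, k2]; ring⟩
        obtain ⟨v', rfl⟩ := this
        have hgk : g' * k = v' ^ 2 := by linarith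
        have hgk1 : Int.gcd g' k = 1 := by
          rw [← Int.isCoprime_iff_gcd_eq_one] at k4 ⊢
          exact k4.of_mul_left_right
        obtain ⟨β, hβ | hβ⟩ := Int.sq_of_gcd_eq_one hgk1 hgk
        swap
        · nlinarith [sq_nonneg β]
        obtain ⟨α, hα | hα⟩ := Int.sq_of_gcd_eq_one ((Int.gcd_comm _ _).trans hgk1) ((mul_comm _ _).trans hgk)
        swap
        · nlinarith [sq_nonneg α]
        refine ih u.natAbs ?_ α β u rfl ?_ ?_ ?_
        · rw [← hr]
          apply Int.natAbs_lt_iff_sq_lt.mpr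
          rw [← hu]
          have i1 : m ≤ m ^ 2 := by nlinarith only [hm]
          have i2 : m < r := by rw [h3]; nlinarith only [i1, hn]
          nlinarith only [hm, i2]
        · rintro rfl; simp at hα; omega
        · rintro rfl; simp at hβ; omega
        · rw [← hu, k3, hα, hβ]; ring
      rcases k5 with ⟨h, -⟩ | ⟨-, h⟩
      · exact fin g k hg hk k4 k2 k3 h
      · exact fin k g hk hg ((Int.gcd_comm _ _).trans k4) (by linarith) (by linarith) h
    rcases lt_or_gt_of_ne hr0 with h0 | h0
    · exact key (-r) (by omega) (by omega) (by linarith)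
    · exact key r h0 hr h

theorem fq_clear (c : ℤ) (hc : ∀ p q r : ℤ, p ≠ 0 → q ≠ 0 → p ^ 4 + c * q ^ 4 = r ^ 2 → False)
    (p q r : ℚ) (hp : p ≠ 0) (hq : q ≠ 0) : p ^ 4 + c * q ^ 4 ≠ r ^ 2 := by
  intro h
  have a0 : (p.den : ℚ) ≠ 0 := by exact_mod_cast p.den_nz
  have b0 : (q.den : ℚ) ≠ 0 := by exact_mod_cast q.den_nz
  have c0 : (r.den : ℚ) ≠ 0 := by exact_mod_cast r.den_nz
  have e1 := Rat.num_div_den p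
  have e2 := Rat.num_div_den q
  have e3 := Rat.num_div_den r
  refine hc (p.num * q.den * r.den) (q.num * p.den * r.den)
    (r.num * p.den ^ 2 * q.den ^ 2 * r.den) ?_ ?_ ?_
  · simp [hp]
  · simp [hq]
  · rw [← e1, ← e2, ← e3] at h
    field_simp at h
    have h2 : (p.num * q.den * r.den : ℚ) ^ 4 + c * (q.num * p.den * r.den) ^ 4 =
      (r.num * p.den ^ 2 * q.den ^ 2 * r.den) ^ 2 := by
      linear_combination r.den ^ 2 * h
    exact_mod_cast h2

theorem fq_two_sq (x : ℚ) : x ^ 2 ≠ 2 := by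
  intro h
  have : IsSquare (2 : ℚ) := ⟨x, by rw [← h]; ring⟩
  revert this; norm_num

theorem fq_c (x : ℚ) : (x ^ 2 - 2 * x - 1) * (x ^ 2 + 2 * x - 1) ≠ 0 := by
  apply mul_ne_zero
  · intro h; exact fq_two_sq (x - 1) (by linear_combination h)
  · intro h; exact fq_two_sq (x + 1) (by linear_combination h)

theorem fq_E1 (x y : ℚ) (h : y ^ 2 = x ^ 3 - x) : y = 0 := by
  by_contra hy
  refine fq_clear 4 (fun p q r h1 h2 h3 => fq_descent _ p q r rfl h1 h2 h3)
    ((x ^ 2 - 2 * x - 1) * (x ^ 2 + 2 * x - 1)) ((x ^ 2 + 1) * (2 * y))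
    ((x ^ 2 + 1) ^ 4 + (2 * y) ^ 4) (fq_c x) (mul_ne_zero (by positivity) (by positivity)) ?_
  push_cast
  have : y ^ 4 = (x ^ 3 - x) ^ 2 := by rw [← h]; ring
  rw [mul_pow _ (2 * y), mul_pow 2 y, this]; ring

theorem fq_E2 (x y : ℚ) (h : 2 * y ^ 2 = x ^ 3 - x) : y = 0 := by
  by_contra hy
  refine fq_clear 1 (fun p q r h1 h2 h3 => not_fermat_42 h1 h2 (by linarith))
    ((x ^ 2 - 2 * x - 1) * (x ^ 2 + 2 * x - 1)) (2 * (x ^ 2 + 1) * (2 * y))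
    ((x ^ 2 + 1) ^ 4 + 4 * (2 * y) ^ 4) (fq_c x) (mul_ne_zero (by positivity) (by positivity)) ?_
  push_cast
  have : y ^ 4 = (x ^ 3 - x) ^ 2 / 4 := by rw [← h]; ring
  rw [mul_pow _ (2 * y), mul_pow 2 y, this]; ring

structure FQD (K : Type*) [Field K] where
  i : K
  s : K
  w : K
  c : K →+* K
  t : K →+* K
  σ : K →+* K
  hi : i ^ 2 = -1
  hs : s ^ 2 = 2
  hw : w ^ 2 = -7
  ci : c i = -i
  cs : c s = s
  cw : c w = w
  ti : t i = i
  ts : t s = -s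
  tw : t w = w
  σi : σ i = i
  σs : σ s = s
  σw : σ w = -w
  cc : ∀ z, c (c z) = z
  tt : ∀ z, t (t z) = z
  σσ : ∀ z, σ (σ z) = z
  ct : ∀ z, c (t z) = t (c z)
  cσ : ∀ z, c (σ z) = σ (c z)
  tσ : ∀ z, t (σ z) = σ (t z)
  rat : ∀ z, c z = z → t z = z → σ z = z → ∃ q : ℚ, z = q

namespace FQD

variable {K : Type*} [Field K] [CharZero K]

theorem nonsq (f : K →+* K) (ff : ∀ z, f (f z) = z) (a b : K) (hab : a * f a = b ^ 2)
    (hb : f b = -b) (hb0 : b ≠ 0) : ¬ IsSquare a := by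
  rintro ⟨z, rfl⟩
  have h1 : (z * f z) ^ 2 = b ^ 2 := by rw [← hab, map_mul]; ring
  have h2 : f (z * f z) = z * f z := by rw [map_mul, ff]; ring
  have h3 : f b = b := by
    rcases sq_eq_sq_iff_eq_or_eq_neg.mp h1 with h | h
    · rw [← h, h2]
    · rw [h, map_neg] at h2; exact neg_injective h2
  rw [h3] at hb
  exact hb0 (self_eq_neg.mp hb)

theorem i_ne (D : FQD K) : D.i ≠ 0 := by
  intro h; have := D.hi; rw [h] at this; norm_num at this

theorem s_ne (D : FQD K) : D.s ≠ 0 := by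
  intro h; have := D.hs; rw [h] at this; norm_num at this

theorem w_ne (D : FQD K) : D.w ≠ 0 := by
  intro h; have := D.hw; rw [h] at this; norm_num at this

theorem nonsq_ct (D : FQD K) (a b : K) (hab : a * D.c (D.t a) = b ^ 2)
    (hb : D.c (D.t b) = -b) (hb0 : b ≠ 0) : ¬ IsSquare a :=
  nonsq (D.c.comp D.t) (fun z => by simp [D.ct, D.cc, D.tt]) a b hab hb hb0

theorem ns_one_i (D : FQD K) (X : K) (h : X ^ 2 = -1) : ¬ IsSquare (X + 1) := by
  have hX : X = D.i ∨ X = -D.i := by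
    rw [← D.hi] at h; exact sq_eq_sq_iff_eq_or_eq_neg.mp h
  refine D.nonsq_ct _ D.s ?_ (by simp [D.ts, D.cs]) D.s_ne
  rcases hX with rfl | rfl <;> simp [D.ti, D.ci] <;> linear_combination -D.hi - D.hs

theorem R_cases (D : FQD K) (X : K) (h : X ^ 2 - 2 * X - 1 = 0 ∨ X ^ 2 + 2 * X - 1 = 0) :
    X = 1 + D.s ∨ X = 1 - D.s ∨ X = -1 + D.s ∨ X = -1 - D.s := by
  rcases h with h | h
  · have : (X - 1) ^ 2 = D.s ^ 2 := by rw [D.hs]; linear_combination h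
    rcases sq_eq_sq_iff_eq_or_eq_neg.mp this with h | h
    · left; linear_combination h
    · right; left; linear_combination h
  · have : (X + 1) ^ 2 = D.s ^ 2 := by rw [D.hs]; linear_combination h
    rcases sq_eq_sq_iff_eq_or_eq_neg.mp this with h | h
    · right; right; left; linear_combination h
    · right; right; right; linear_combination h

theorem ns_R (D : FQD K) (X : K) (h : X ^ 2 - 2 * X - 1 = 0 ∨ X ^ 2 + 2 * X - 1 = 0) :
    ¬ IsSquare X := by
  refine D.nonsq_ct _ D.i ?_ (by simp [D.ti, D.ci]) D.i_ne
  rcases D.R_cases X h with rfl | rfl | rfl | rfl <;> simp [D.ts, D.cs] <;>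
    linear_combination -D.hi - D.hs

theorem ratY (D : FQD K) (X Y : K) (hX : D.c X = X ∧ D.t X = X ∧ D.σ X = X)
    (hc : D.c Y = Y ∨ D.c Y = -Y) (ht : D.t Y = Y ∨ D.t Y = -Y) (hσ : D.σ Y = Y)
    (h : Y ^ 2 = X ^ 3 - X) : Y = 0 := by
  obtain ⟨q, rfl⟩ := D.rat X hX.1 hX.2.1 hX.2.2
  have hs := D.hs
  have hi := D.hi
  rcases hc with hc | hc <;> rcases ht with ht | ht
  · obtain ⟨y, rfl⟩ := D.rat Y hc ht hσ
    exact_mod_cast fq_E1 q y (by exact_mod_cast h)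
  · obtain ⟨y, hy⟩ := D.rat (Y * D.s) (by simp [hc, D.cs]) (by simp [ht, D.ts])
      (by simp [hσ, D.σs])
    have h2 : (y : K) ^ 2 = 2 * (q ^ 3 - q) := by rw [← hy, ← h]; linear_combination Y ^ 2 * hs
    have h3 := fq_E2 q (y / 2) (by
      have : y ^ 2 = 2 * (q ^ 3 - q) := by exact_mod_cast h2
      linear_combination this / 2)
    have : y = 0 := by linarith
    rw [this] at hy
    simpa [D.s_ne] using hy
  · obtain ⟨y, hy⟩ := D.rat (Y * D.i) (by simp [hc, D.ci]) (by simp [ht, D.ti])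
      (by simp [hσ, D.σi])
    have h2 : (y : K) ^ 2 = - (q ^ 3 - q) := by rw [← hy, ← h]; linear_combination Y ^ 2 * hi
    have h3 := fq_E1 (-q) y (by
      have : y ^ 2 = -(q ^ 3 - q) := by exact_mod_cast h2
      linear_combination this)
    rw [h3] at hy
    simpa [D.i_ne] using hy
  · obtain ⟨y, hy⟩ := D.rat (Y * D.i * D.s) (by simp [hc, D.ci, D.cs]) (by simp [ht, D.ti, D.ts])
      (by simp [hσ, D.σi, D.σs])
    have h2 : (y : K) ^ 2 = -2 * (q ^ 3 - q) := by
      rw [← hy, ← h]; linear_combination Y ^ 2 * D.i ^ 2 * hs + 2 * Y ^ 2 * hi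
    have h3 := fq_E2 (-q) (y / 2) (by
      have : y ^ 2 = -2 * (q ^ 3 - q) := by exact_mod_cast h2
      linear_combination this / 2)
    have : y = 0 := by linarith
    rw [this] at hy
    simpa [D.s_ne, D.i_ne] using hy

end FQD

/-- The elliptic curve `y² = x³ - x`. -/
def FQW : WeierstrassCurve ℚ := ⟨0, 0, 0, -1, 0⟩

section
open WeierstrassCurve WeierstrassCurve.Affine

variable {K : Type*} [Field K] [CharZero K]

theorem FQW_eq (X Y : K) : (FQW⁄K).toAffine.Equation X Y ↔ Y ^ 2 = X ^ 3 - X := by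
  rw [WeierstrassCurve.Affine.equation_iff]
  simp [FQW, WeierstrassCurve.baseChange, WeierstrassCurve.map, sub_eq_add_neg]

theorem FQW_ns (X Y : K) (h : Y ^ 2 = X ^ 3 - X) : (FQW⁄K).toAffine.Nonsingular X Y := by
  rw [WeierstrassCurve.Affine.nonsingular_iff, FQW_eq]
  refine ⟨h, ?_⟩
  simp [FQW, WeierstrassCurve.baseChange, WeierstrassCurve.map]
  by_contra! hh
  obtain ⟨h1, h2⟩ := hh
  have hY : Y = 0 := self_eq_neg.mp h2
  subst hY
  have : (2:K) = 0 := by linear_combination -(3 * X ^ 2 - 2) * h1 + 9 * X * h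
  norm_num at this

theorem FQW_negY (X Y : K) : (FQW⁄K).toAffine.negY X Y = -Y := by
  simp [WeierstrassCurve.Affine.negY, FQW, WeierstrassCurve.baseChange, WeierstrassCurve.map]

open scoped Classical in
theorem FQW_dbl (X Y : K) (h : (FQW⁄K).toAffine.Nonsingular X Y) (hY : Y ≠ 0) :
    ∃ X2 Y2 h2, (Point.some X Y h + Point.some X Y h : (FQW⁄K).toAffine.Point) = Point.some X2 Y2 h2 ∧
      X2 * (2 * Y) ^ 2 = (X ^ 2 + 1) ^ 2 := by
  have hne : Y ≠ (FQW⁄K).toAffine.negY X Y := by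
    rw [FQW_negY]; exact fun h => hY (self_eq_neg.mp h)
  refine ⟨_, _, _, Point.add_self_of_Y_ne hne, ?_⟩
  rw [slope_of_Y_ne rfl hne, FQW_negY]
  have he := (FQW_eq X Y).mp h.1
  simp [WeierstrassCurve.Affine.addX, FQW, WeierstrassCurve.baseChange, WeierstrassCurve.map]
  have : Y + Y ≠ 0 := by rw [← two_mul]; exact mul_ne_zero two_ne_zero hY
  field_simp
  linear_combination (-32 * X) * he

open scoped Classical in
theorem FQW_dbl0 (X Y : K) (h : (FQW⁄K).toAffine.Nonsingular X Y) 
    (h2 : (Point.some X Y h + Point.some X Y h : (FQW⁄K).toAffine.Point) = 0) : Y = 0 := by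
  by_contra hY
  obtain ⟨X2, Y2, h3, h4, -⟩ := FQW_dbl X Y h hY
  rw [h4] at h2
  exact Point.some_ne_zero _ h2

open scoped Classical in
theorem FQW_tors (D : FQD K) (U : (FQW⁄K).toAffine.Point)
    (hc : Point.map D.c.toRatAlgHom U = U ∨ Point.map D.c.toRatAlgHom U = -U)
    (ht : Point.map D.t.toRatAlgHom U = U ∨ Point.map D.t.toRatAlgHom U = -U)
    (hσ : Point.map D.σ.toRatAlgHom U = U) : U + U = 0 := by
  rcases U with _ | ⟨X, Y, h⟩
  · exact add_zero _
  · have key : ∀ f : K →+* K, (Point.map f.toRatAlgHom (Point.some X Y h : (FQW⁄K).toAffine.Point) = Point.some X Y h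
        → f X = X ∧ f Y = Y) ∧ (Point.map f.toRatAlgHom (Point.some X Y h : (FQW⁄K).toAffine.Point) = -Point.some X Y h
        → f X = X ∧ f Y = -Y) := by
      intro f
      rw [Point.map_some, Point.neg_some]
      simp only [Point.some.injEq, FQW_negY, RingHom.toRatAlgHom_apply]
      exact ⟨id, id⟩
    have hσ' := (key D.σ).1 hσ
    have hc' : D.c X = X ∧ (D.c Y = Y ∨ D.c Y = -Y) := by
      rcases hc with h | h
      · exact ⟨((key _).1 h).1, Or.inl ((key _).1 h).2⟩
      · exact ⟨((key _).2 h).1, Or.inr ((key _).2 h).2⟩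
    have ht' : D.t X = X ∧ (D.t Y = Y ∨ D.t Y = -Y) := by
      rcases ht with h | h
      · exact ⟨((key _).1 h).1, Or.inl ((key _).1 h).2⟩
      · exact ⟨((key _).2 h).1, Or.inr ((key _).2 h).2⟩
    have hY := D.ratY X Y ⟨hc'.1, ht'.1, hσ'.1⟩ hc'.2 ht'.2 hσ'.2 ((FQW_eq X Y).mp h.1)
    apply Point.add_self_of_Y_eq
    rw [FQW_negY, hY, neg_zero]

open scoped Classical in
theorem FQW_eight (D : FQD K) (T : (FQW⁄K).toAffine.Point)
    (hσ : Point.map D.σ.toRatAlgHom T = T) : ((T + T) + (T + T)) + ((T + T) + (T + T)) = 0 := by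
  set C := Point.map (W' := FQW) D.c.toRatAlgHom
  set S := Point.map (W' := FQW) D.t.toRatAlgHom
  set G := Point.map (W' := FQW) D.σ.toRatAlgHom
  have mapext : ∀ (f g : K →+* K) (P : (FQW⁄K).toAffine.Point), (∀ z, f z = g z) →
      Point.map f.toRatAlgHom P = Point.map g.toRatAlgHom P := by
    intro f g P h; rw [RingHom.ext h]
  have hcomp : ∀ (f g : K →+* K) (P : (FQW⁄K).toAffine.Point),
      Point.map f.toRatAlgHom (Point.map g.toRatAlgHom P) = Point.map (f.comp g).toRatAlgHom P := by
    intro f g P; rw [Point.map_map]; rfl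
  have hid : ∀ P : (FQW⁄K).toAffine.Point, Point.map (RingHom.id K).toRatAlgHom P = P := by
    intro P; cases P <;> rfl
  have CC : ∀ P, C (C P) = P := fun P => by
    rw [hcomp, mapext _ (RingHom.id K) _ (by simp [D.cc]), hid]
  have SS : ∀ P, S (S P) = P := fun P => by
    rw [hcomp, mapext _ (RingHom.id K) _ (by simp [D.tt]), hid]
  have CS : ∀ P, C (S P) = S (C P) := fun P => by
    rw [hcomp, hcomp]; exact mapext _ _ _ (by simp [D.ct])
  have GC : ∀ P, G (C P) = C (G P) := fun P => by
    rw [hcomp, hcomp]; exact mapext _ _ _ (by simp [D.cσ])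
  have GS : ∀ P, G (S P) = S (G P) := fun P => by
    rw [hcomp, hcomp]; exact mapext _ _ _ (by simp [D.tσ])
  have t1 := FQW_tors D (T + C T + S T + S (C T))
    (Or.inl (by change C _ = _; simp only [map_add, CC, CS]; abel))
    (Or.inl (by change S _ = _; simp only [map_add, SS]; abel))
    (by change G _ = _; simp only [map_add, GC, GS]; rw [show G T = T from hσ])
  have t2 := FQW_tors D (T - C T + S T - S (C T))
    (Or.inr (by change C _ = _; simp only [map_add, map_sub, CC, CS]; abel))
    (Or.inl (by change S _ = _; simp only [map_add, map_sub, SS]; abel))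
    (by change G _ = _; simp only [map_add, map_sub, GC, GS]; rw [show G T = T from hσ])
  have t3 := FQW_tors D (T + C T - S T - S (C T))
    (Or.inl (by change C _ = _; simp only [map_add, map_sub, CC, CS]; abel))
    (Or.inr (by change S _ = _; simp only [map_add, map_sub, SS]; abel))
    (by change G _ = _; simp only [map_add, map_sub, GC, GS]; rw [show G T = T from hσ])
  have t4 := FQW_tors D (T - C T - S T + S (C T))
    (Or.inr (by change C _ = _; simp only [map_add, map_sub, CC, CS]; abel))
    (Or.inr (by change S _ = _; simp only [map_add, map_sub, SS]; abel))
    (by change G _ = _; simp only [map_add, map_sub, GC, GS]; rw [show G T = T from hσ])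
  have := congrArg₂ (· + ·) (congrArg₂ (· + ·) t1 t2) (congrArg₂ (· + ·) t3 t4)
  simp only [add_zero] at this
  rw [← this]; abel

theorem FQ_half (X Y X2 : K) (hY : Y ≠ 0) (h : Y ^ 2 = X ^ 3 - X)
    (h2 : X2 * (2 * Y) ^ 2 = (X ^ 2 + 1) ^ 2) (h3 : X2 ^ 3 - X2 = 0) :
    X ^ 2 = -1 ∨ X ^ 2 - 2 * X - 1 = 0 ∨ X ^ 2 + 2 * X - 1 = 0 := by
  have : X2 * ((X2 - 1) * (X2 + 1)) = 0 := by linear_combination h3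
  rcases mul_eq_zero.mp this with h4 | h4
  · left
    rw [h4, zero_mul] at h2
    have := pow_eq_zero_iff (two_ne_zero) |>.mp h2.symm
    linear_combination this
  right
  rcases mul_eq_zero.mp h4 with h4 | h4
  · left
    rw [← pow_eq_zero_iff (two_ne_zero)]
    linear_combination (4) * h - h2 + (2 * Y) ^ 2 * h4
  · right
    rw [← pow_eq_zero_iff (two_ne_zero)]
    linear_combination (-4) * h - h2 + (2 * Y) ^ 2 * h4

open scoped Classical in
theorem FQ_Ek (D : FQD K) (X Y : K) (h : Y ^ 2 = X ^ 3 - X) (hX : D.σ X = X) (hY : D.σ Y = Y) :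
    (X = 0 ∨ X = 1 ∨ X = -1) ∨ X ^ 2 = -1 ∨ X ^ 2 - 2 * X - 1 = 0 ∨ X ^ 2 + 2 * X - 1 = 0 := by
  by_cases hY0 : Y = 0
  · left
    have : X * ((X - 1) * (X + 1)) = 0 := by rw [hY0] at h; linear_combination -h
    rcases mul_eq_zero.mp this with h4 | h4
    · exact Or.inl h4
    rcases mul_eq_zero.mp h4 with h4 | h4
    · exact Or.inr (Or.inl (by linear_combination h4))
    · exact Or.inr (Or.inr (by linear_combination h4))
  right
  have hns := FQW_ns X Y h
  have h8 := FQW_eight D (Point.some X Y hns) (by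
    rw [Point.map_some]; simp only [Point.some.injEq, RingHom.toRatAlgHom_apply]; exact ⟨hX, hY⟩)
  obtain ⟨X2, Y2, n2, e2, r2⟩ := FQW_dbl X Y hns hY0
  have q2 := (FQW_eq X2 Y2).mp n2.1
  rw [e2] at h8
  by_cases hY2 : Y2 = 0
  · exact FQ_half X Y X2 hY0 h r2 (by rw [← q2, hY2]; ring)
  exfalso
  obtain ⟨X3, Y3, n3, e3, r3⟩ := FQW_dbl X2 Y2 n2 hY2
  rw [e3] at h8
  have hY3 := FQW_dbl0 X3 Y3 n3 h8
  have q3 := (FQW_eq X3 Y3).mp n3.1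
  have hsq : IsSquare X2 := ⟨(X ^ 2 + 1) / (2 * Y), by field_simp; linear_combination r2⟩
  have hsq1 : IsSquare (X2 + 1) :=
    ⟨(X ^ 2 + 2 * X - 1) / (2 * Y), by field_simp; linear_combination r2 + 4 * h⟩
  rcases FQ_half X2 Y2 X3 hY2 q2 r3 (by rw [← q3, hY3]; ring) with h | h
  · exact D.ns_one_i _ h hsq1
  · exact D.ns_R _ h hsq

end

section
variable {K : Type*} [Field K] [CharZero K]

theorem FQ_pm (D : FQD K) (y : K) (hy : y ≠ 0) (h : D.σ (y ^ 4) = y ^ 4) :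
    D.σ y = y ∨ D.σ y = -y := by
  have hi := D.hi
  rw [map_pow] at h
  have h1 : (D.σ y - y) * ((D.σ y + y) * ((D.σ y - D.i * y) * (D.σ y + D.i * y))) = 0 := by
    linear_combination h - (D.σ y ^ 2 - y ^ 2) * y ^ 2 * hi
  have hss := D.σσ y
  rcases mul_eq_zero.mp h1 with h1 | h1
  · left; linear_combination h1
  rcases mul_eq_zero.mp h1 with h1 | h1
  · right; linear_combination h1
  exfalso
  rcases mul_eq_zero.mp h1 with h1 | h1
  · have h2 : D.σ y = D.i * y := by linear_combination h1
    rw [h2, map_mul, D.σi, h2] at hss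
    have : 2 * y = 0 := by linear_combination -hss + y * hi
    simp [hy] at this
  · have h2 : D.σ y = -(D.i * y) := by linear_combination h1
    rw [h2, map_neg, map_mul, D.σi, h2] at hss
    have : 2 * y = 0 := by linear_combination -hss + y * hi
    simp [hy] at this

theorem FQ_param (D : FQD K) (x y : K) (h : x ^ 4 + y ^ 4 = 1) (hx : x ≠ 0) (hy : y ≠ 0) :
    ∃ X Y : K, Y ^ 2 = X ^ 3 - X ∧ X ≠ 0 ∧ Y ≠ 0 ∧ x * Y = (1 - D.i) * X ∧
      y ^ 2 * (X ^ 2 - 1) = X ^ 2 + 1 ∧ X * x ^ 2 = -D.i * (1 + y ^ 2) := by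
  have hi := D.hi
  have h1 : 1 + y ^ 2 ≠ 0 := by
    intro h1
    have : x ^ 4 = 0 := by linear_combination h + (1 - y ^ 2) * h1
    exact hx (by simpa using this)
  have h2 : 1 + D.i ≠ 0 := by
    intro h2
    have : (2 : K) = 0 := by linear_combination (1 - D.i) * h2 + hi
    norm_num at this
  refine ⟨-D.i * (1 + y ^ 2) / x ^ 2, -(1 + D.i) * (1 + y ^ 2) / x ^ 3, ?_, ?_, ?_, ?_, ?_, ?_⟩
  · field_simp
    have hx4 : x ^ 4 = 1 - y ^ 4 := by linear_combination h
    have hi3 : D.i ^ 3 = - D.i := by linear_combination D.i * hi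
    ring_nf
    simp only [hx4, hi3, hi]
    ring
  · exact div_ne_zero (mul_ne_zero (neg_ne_zero.mpr D.i_ne) h1) (by positivity)
  · exact div_ne_zero (mul_ne_zero (neg_ne_zero.mpr h2) h1) (by positivity)
  · field_simp
    linear_combination (-1) * hi
  · field_simp
    have hx4 : x ^ 4 = 1 - y ^ 4 := by linear_combination h
    ring_nf
    simp only [hx4, hi]
    ring
  · field_simp

theorem FQ_A1 (D : FQD K) (x y : K) (h : x ^ 4 + y ^ 4 = 1) (hx : x ≠ 0) (hy : y ≠ 0)
    (hσ : D.σ x = x) : False := by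
  obtain ⟨X, Y, e, hX, hY, e1, e2, e3⟩ := FQ_param D x y h hx hy
  have hy4 : D.σ (y ^ 4) = y ^ 4 := by
    have : y ^ 4 = 1 - x ^ 4 := by linear_combination h
    rw [this]; simp [hσ]
  have hy2 : D.σ y ^ 2 = y ^ 2 := by
    rcases FQ_pm D y hy hy4 with h | h <;> rw [h]; ring
  have hX' : D.σ X = X := by
    have := congrArg D.σ e3
    simp only [map_mul, map_pow, map_neg, map_add, map_one, D.σi, hσ, hy2] at this
    rw [← e3] at this
    exact mul_right_cancel₀ (pow_ne_zero 2 hx) this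
  have hY' : D.σ Y = Y := by
    have := congrArg D.σ e1
    simp only [map_mul, map_sub, map_one, D.σi, hσ, hX'] at this
    rw [← e1] at this
    exact mul_left_cancel₀ hx this
  have key := FQ_Ek D X Y e hX' hY'
  have hYY : X ^ 3 - X ≠ 0 := by rw [← e]; exact pow_ne_zero 2 hY
  rcases key with (rfl | rfl | rfl) | h5 | h5
  · exact hX rfl
  · norm_num at hYY
  · norm_num at hYY
  · rw [h5] at e2
    have : y ^ 2 = 0 := by linear_combination (-1/2) * e2
    exact hy (by simpa using this)
  · have hs : y ^ 4 = 2 := by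
      have hXX : X ^ 2 - 1 ≠ 0 := by
        intro h0; apply hYY; linear_combination X * h0
      have h6 : (X ^ 2 + 1) ^ 2 = 2 * (X ^ 2 - 1) ^ 2 := by
        rcases h5 with h5 | h5
        · linear_combination -(X ^ 2 + 2 * X - 1) * h5
        · linear_combination -(X ^ 2 - 2 * X - 1) * h5
      rw [← e2] at h6
      have : (y ^ 4 - 2) * (X ^ 2 - 1) ^ 2 = 0 := by linear_combination h6
      rcases mul_eq_zero.mp this with h7 | h7
      · linear_combination h7
      · exact absurd h7 (pow_ne_zero 2 hXX)
    have hs2 : (y ^ 2) ^ 2 = D.s ^ 2 := by rw [D.hs, ← hs]; ring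
    have hsn : ∀ a : K, a = D.s ∨ a = - D.s → ¬ IsSquare a := by
      intro a ha
      refine FQD.nonsq D.t D.tt a (D.i * D.s) ?_ (by simp [D.ti, D.ts]) (mul_ne_zero D.i_ne D.s_ne)
      rcases ha with rfl | rfl <;> simp [D.ts] <;> linear_combination (-D.s ^ 2) * D.hi
    exact hsn (y ^ 2) (sq_eq_sq_iff_eq_or_eq_neg.mp hs2) ⟨y, by ring⟩

theorem FQ_zeta (D : FQD K) : ∃ z : K, z ^ 2 = D.i ∧ D.σ z = z := by
  refine ⟨(1 + D.i) / D.s, ?_, by simp [D.σi, D.σs]⟩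
  have := D.s_ne
  field_simp
  linear_combination D.hi - D.i * D.hs

theorem FQ_A (D : FQD K) (x y : K) (h : x ^ 4 + y ^ 4 = 1) (hx : x ≠ 0) (hy : y ≠ 0)
    (hσ : D.σ x = x ∨ D.σ x = -x) : False := by
  rcases hσ with hσ | hσ
  · exact FQ_A1 D x y h hx hy hσ
  have hy4 : D.σ (y ^ 4) = y ^ 4 := by
    have : y ^ 4 = 1 - x ^ 4 := by linear_combination h
    rw [this]; simp only [map_sub, map_one, map_pow, hσ]; ring
  rcases FQ_pm D y hy hy4 with h1 | h1
  · exact FQ_A1 D y x (by linear_combination h) hy hx h1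
  · obtain ⟨z, hz, hz2⟩ := FQ_zeta D
    have hz0 : z ≠ 0 := by rintro rfl; apply D.i_ne; rw [← hz]; ring
    refine FQ_A1 D (z * x / y) (1 / y) ?_ (div_ne_zero (mul_ne_zero hz0 hx) hy) (one_div_ne_zero hy) ?_
    · field_simp
      have : z ^ 4 = -1 := by rw [← D.hi, ← hz]; ring
      linear_combination x ^ 4 * this - h
    · simp [hσ, h1, hz2]

theorem FQ_types (D : FQD K) (x y : K) (h : x ^ 4 + y ^ 4 = 1) (hx : x ≠ 0) (hy : y ≠ 0) :
    (1 + y ^ 2) * D.σ (1 + y ^ 2) ≠ 0 ∧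
    (1 + y ^ 2 - D.i * x ^ 2) * D.σ (1 + y ^ 2 - D.i * x ^ 2) ≠ 0 ∧
    ∃ τ : K, IsSquare ((1 + y ^ 2) * D.σ (1 + y ^ 2) * τ) ∧
      IsSquare ((1 + y ^ 2 - D.i * x ^ 2) * D.σ (1 + y ^ 2 - D.i * x ^ 2) * (τ - 1)) ∧
      (((τ = 1 ∨ τ = -1) ∧ (x * D.σ x) ^ 4 = 1) ∨
       (τ ^ 2 = -1 ∧ (y * D.σ y) ^ 8 = 16 * (x * D.σ x) ^ 4) ∨
       (τ ^ 2 - 2 * τ - 1 = 0 ∨ τ ^ 2 + 2 * τ - 1 = 0)) := by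
  obtain ⟨X, Y, e, hX, hY, e1, e2, e3⟩ := FQ_param D x y h hx hy
  have hi := D.hi
  have hYY : X ^ 3 - X ≠ 0 := by rw [← e]; exact pow_ne_zero 2 hY
  have e4 : (X - 1) * x ^ 2 = -D.i * (1 + y ^ 2 - D.i * x ^ 2) := by
    linear_combination e3 - x ^ 2 * hi
  have hg : 1 + y ^ 2 ≠ 0 := by
    intro h0; rw [h0] at e3
    have : X * x ^ 2 = 0 := by linear_combination e3
    simp [hX, hx] at this
  have hh : 1 + y ^ 2 - D.i * x ^ 2 ≠ 0 := by
    intro h0; rw [h0] at e4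
    have : (X - 1) * x ^ 2 = 0 := by linear_combination e4
    rcases mul_eq_zero.mp this with h1 | h1
    · apply hYY; linear_combination (X ^ 2 + X) * h1
    · simp [hx] at h1
  have ne0 : ∀ z : K, z ≠ 0 → z * D.σ z ≠ 0 := fun z hz =>
    mul_ne_zero hz ((map_ne_zero D.σ).mpr hz)
  refine ⟨ne0 _ hg, ne0 _ hh, ?_⟩
  have ex : D.σ x * D.σ Y = (1 - D.i) * D.σ X := by
    have := congrArg D.σ e1; simpa [D.σi] using this
  have ex3 : D.σ X * D.σ x ^ 2 = -D.i * D.σ (1 + y ^ 2) := by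
    have := congrArg D.σ e3; simpa [D.σi] using this
  have ex4 : (D.σ X - 1) * D.σ x ^ 2 = -D.i * D.σ (1 + y ^ 2 - D.i * x ^ 2) := by
    have := congrArg D.σ e4; simpa [D.σi] using this
  have ex2 : D.σ y ^ 2 * (D.σ X ^ 2 - 1) = D.σ X ^ 2 + 1 := by
    have := congrArg D.σ e2; simpa [D.σi] using this
  have e' : D.σ Y ^ 2 = D.σ X ^ 3 - D.σ X := by
    have := congrArg D.σ e; simpa [D.σi] using this
  have hne : X - D.σ X ≠ 0 := by
    intro h0
    have h1 : D.σ X = X := by linear_combination -h0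
    have h2 : D.σ Y ^ 2 = Y ^ 2 := by rw [e', e, h1]
    rw [h1] at ex
    apply FQ_A D x y h hx hy
    rcases sq_eq_sq_iff_eq_or_eq_neg.mp h2 with h3 | h3
    · left; rw [h3, ← e1] at ex; exact mul_right_cancel₀ hY ex
    · right; rw [h3, ← e1] at ex; exact mul_right_cancel₀ hY (by linear_combination -ex)
  have hxσ : D.σ x ≠ x := fun h0 => FQ_A D x y h hx hy (Or.inl h0)
  have hX' : D.σ X ≠ 0 := (map_ne_zero D.σ).mpr hX
  have hY' : D.σ Y ≠ 0 := (map_ne_zero D.σ).mpr hY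
  have hx' : D.σ x ≠ 0 := (map_ne_zero D.σ).mpr hx
  obtain ⟨l, hl⟩ : ∃ l, l = (Y - D.σ Y) / (X - D.σ X) := ⟨_, rfl⟩
  have hl1 : l * (X - D.σ X) = Y - D.σ Y := by rw [hl]; field_simp
  have hlσ : D.σ l = l := by
    rw [hl, map_div₀, map_sub, map_sub, D.σσ, D.σσ, ← neg_sub X, ← neg_sub Y, neg_div_neg_eq]
  obtain ⟨ν, hν⟩ : ∃ ν, ν = Y - l * X := ⟨_, rfl⟩
  have hνσ : D.σ ν = ν := by
    rw [hν, map_sub, map_mul, hlσ]; linear_combination hl1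
  obtain ⟨τ, hτ⟩ : ∃ τ, τ = l ^ 2 - X - D.σ X := ⟨_, rfl⟩
  have hτσ : D.σ τ = τ := by
    rw [hτ, map_sub, map_sub, map_pow, hlσ, D.σσ]; ring
  have hYe : Y = l * X + ν := by rw [hν]; ring
  have hYe' : D.σ Y = l * D.σ X + ν := by rw [hν]; linear_combination hl1
  have hNy : D.σ (1 + y ^ 2) = 1 + D.σ y ^ 2 := by simp
  generalize D.σ X = X' at *
  generalize D.σ Y = Y' at *
  generalize D.σ x = x' at *
  generalize D.σ y = y' at *
  generalize D.σ (1 + y ^ 2) = g' at *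
  generalize D.σ (1 + y ^ 2 - D.i * x ^ 2) = h' at *
  have v1 : X * X' + τ * (X + X') + 1 + 2 * l * ν = 0 := by
    apply mul_left_cancel₀ hne
    rw [hYe] at e; rw [hYe'] at e'
    rw [hτ]
    linear_combination e - e'
  have v2 : X * X' * τ = ν ^ 2 := by
    rw [hYe] at e
    linear_combination -e + X * v1 - X ^ 2 * hτ
  have vr : ∀ r : K, r ^ 3 = r → (X - r) * (X' - r) * (τ - r) = (l * r + ν) ^ 2 := by
    intro r hr
    linear_combination v2 - r * v1 + r ^ 2 * hτ - hr
  have hT := FQ_Ek D τ (l * τ + ν) (by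
    linear_combination -v2 + τ * v1 - τ ^ 2 * hτ) hτσ (by simp [hlσ, hνσ, hτσ])
  refine ⟨τ, ⟨D.i * (x * x') * ν, ?_⟩, ⟨D.i * (x * x') * (l + ν), ?_⟩, ?_⟩
  · have := vr 0 (by ring)
    have h1 : X * X' * (x * x') ^ 2 = - ((1 + y ^ 2) * g') := by
      linear_combination (X' * x' ^ 2) * e3 - D.i * (1 + y ^ 2) * ex3 + ((1 + y ^ 2) * g') * hi
    linear_combination τ * h1 - (x * x') ^ 2 * v2 - (x * x') ^ 2 * ν ^ 2 * hi
  · have := vr 1 (by ring)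
    have h1 : (X - 1) * (X' - 1) * (x * x') ^ 2 = - ((1 + y ^ 2 - D.i * x ^ 2) * h') := by
      linear_combination ((X' - 1) * x' ^ 2) * e4 - D.i * (1 + y ^ 2 - D.i * x ^ 2) * ex4
        + ((1 + y ^ 2 - D.i * x ^ 2) * h') * hi
    linear_combination (τ - 1) * h1 - (x * x') ^ 2 * this - (x * x') ^ 2 * (l + ν) ^ 2 * hi
  have nx : (x * x') * (Y * Y') = -2 * D.i * (X * X') := by
    linear_combination (x' * Y') * e1 + (1 - D.i) * X * ex + X * X' * hi
  have hr : ∀ r : K, r ^ 2 = 1 → τ = r → (x * x') ^ 4 = 1 := by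
    intro r hr2 hτr
    have h1 : l * r + ν = 0 := by
      have := vr r (by linear_combination r * hr2)
      rw [hτr, sub_self, mul_zero] at this
      exact (pow_eq_zero_iff two_ne_zero).mp this.symm
    have hν1 : ν = - l * r := by linear_combination h1
    subst hτr
    rw [hν1] at v1 v2 hYe hYe'
    have h2 : Y * Y' = 2 * τ * (X * X') := by
      have a1 : X * X' = τ * l ^ 2 := by
        linear_combination τ * v2 + (τ * l ^ 2 - X * X') * hr2
      rw [hYe, hYe']
      have a2 : (X - τ) * (X' - τ) = 2 := by
        linear_combination -v1 + (1) * hr2 + 2 * a1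
      linear_combination l ^ 2 * a2 - 2 * τ * a1 - 2 * l ^ 2 * hr2
    rw [h2] at nx
    have h3 : τ * (x * x') = - D.i := by
      apply mul_left_cancel₀ (mul_ne_zero two_ne_zero (mul_ne_zero hX hX'))
      linear_combination nx
    have h4 : x * x' = - D.i * τ := by linear_combination τ * h3 - x * x' * hr2
    rw [h4]
    have : D.i ^ 4 = 1 := by linear_combination (D.i ^ 2 - 1) * hi
    have h5 : τ ^ 4 = 1 := by linear_combination (τ ^ 2 + 1) * hr2
    linear_combination τ ^ 4 * this + h5
  rcases hT with (h0 | h0 | h0) | h0 | h0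
  · exfalso
    rw [h0, mul_zero] at v2
    have hν0 : ν = 0 := (pow_eq_zero_iff two_ne_zero).mp v2.symm
    rw [hν0, add_zero] at hYe hYe'
    apply hxσ
    have hl0 : l ≠ 0 := by rintro rfl; simp at hYe; exact hY hYe
    rw [hYe] at e1; rw [hYe'] at ex
    have a1 : x * l = 1 - D.i := mul_right_cancel₀ hX (by linear_combination e1)
    have a2 : x' * l = 1 - D.i := mul_right_cancel₀ hX' (by linear_combination ex)
    exact mul_right_cancel₀ hl0 (a2.trans a1.symm)
  · left; exact ⟨Or.inl h0, hr 1 (by norm_num) h0⟩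
  · left; exact ⟨Or.inr h0, hr (-1) (by norm_num) h0⟩
  · right; left
    refine ⟨h0, ?_⟩
    obtain ⟨p, hp⟩ : ∃ p, p = X * X' := ⟨_, rfl⟩
    obtain ⟨q, hq⟩ : ∃ q, q = X + X' := ⟨_, rfl⟩
    have l2 : l ^ 2 = τ + q := by rw [hτ, hq]; ring
    have lv : 2 * l * ν = - (p + τ * q + 1) := by rw [hp, hq]; linear_combination v1
    have vv : ν ^ 2 = p * τ := by rw [hp]; exact v2.symm
    have hu : (p - 1 - τ * q) ^ 2 = -8 * p := by
      have : 4 * (τ + q) * (p * τ) = (p + τ * q + 1) ^ 2 := by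
        rw [← l2, ← vv]; linear_combination (2 * l * ν - (p + τ * q + 1)) * lv
      linear_combination -this + 4 * p * h0
    have hyy : 2 * (Y * Y') = 4 * (p * τ) + q * (p - 1 - τ * q) := by
      have : 2 * (Y * Y') = 2 * l ^ 2 * p + 2 * l * ν * q + 2 * ν ^ 2 := by
        rw [hYe, hYe', hp, hq]; ring
      rw [this, lv, l2, vv]; ring
    have hN : (X ^ 2 + 1) * (X' ^ 2 + 1) = 4 * τ * (Y * Y') := by
      have : (X ^ 2 + 1) * (X' ^ 2 + 1) = (p - 1) ^ 2 + q ^ 2 := by rw [hp, hq]; ring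
      rw [this]
      linear_combination (-2 * τ) * hyy + hu + (-8 * p + q ^ 2) * h0
    have hN2 : (X ^ 2 - 1) * (X' ^ 2 - 1) * p = (Y * Y') ^ 2 := by
      rw [hp, mul_pow, e, e']; ring
    have hyn : (y * y') ^ 2 * (Y * Y') = 4 * τ * p := by
      apply mul_right_cancel₀ (mul_ne_zero hY hY')
      linear_combination -(y * y') ^ 2 * hN2 + p * hN + p * (y' ^ 2 * (X' ^ 2 - 1)) * e2
        + p * (X ^ 2 + 1) * ex2
    rw [← hp] at nx
    have hfin : (y * y') ^ 2 = 2 * D.i * τ * (x * x') := by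
      apply mul_right_cancel₀ (mul_ne_zero hY hY')
      linear_combination hyn - 2 * D.i * τ * nx + 4 * τ * p * hi
    have : (y * y') ^ 8 = ((y * y') ^ 2) ^ 4 := by ring
    rw [this, hfin]
    have i4 : D.i ^ 4 = 1 := by linear_combination (D.i ^ 2 - 1) * hi
    have h5 : τ ^ 4 = 1 := by linear_combination (τ ^ 2 - 1) * h0
    linear_combination 16 * (x * x') ^ 4 * (τ ^ 4 * i4 + h5)
  · right; right; exact h0

end

section
variable {K : Type*} [Field K] [CharZero K]

theorem FQ_m3 (D : FQD K) (r : K) : r ^ 2 ≠ -3 := by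
  intro hr
  have hf : ∀ f : K →+* K, f r = r ∨ f r = -r := by
    intro f
    apply sq_eq_sq_iff_eq_or_eq_neg.mp
    rw [← map_pow, hr, map_neg, map_ofNat]
  have key : ∀ e : K, ∀ a : ℚ, e ^ 2 = a → ¬ IsSquare (-3 * a) →
      D.c (r * e) = r * e → D.t (r * e) = r * e → D.σ (r * e) = r * e → False := by
    intro e a he ha h1 h2 h3
    obtain ⟨q, hq⟩ := D.rat _ h1 h2 h3
    apply ha
    refine ⟨q, ?_⟩
    have : ((-3 * a : ℚ) : K) = (q * q : ℚ) := by
      push_cast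
      rw [← hq, ← he]; linear_combination (-e ^ 2) * hr
    exact_mod_cast this
  have hi := D.hi
  have hs := D.hs
  have hw := D.hw
  rcases hf D.c with h1 | h1 <;> rcases hf D.t with h2 | h2 <;> rcases hf D.σ with h3 | h3
  · exact key 1 1 (by norm_num) (by norm_num) (by simp [h1]) (by simp [h2]) (by simp [h3])
  · exact key D.w (-7) (by push_cast; exact hw) (by norm_num) (by simp [h1, D.cw])
      (by simp [h2, D.tw]) (by simp [h3, D.σw])
  · exact key D.s 2 (by push_cast; exact hs) (by norm_num) (by simp [h1, D.cs])
      (by simp [h2, D.ts]) (by simp [h3, D.σs])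
  · exact key (D.s * D.w) (-14) (by push_cast; rw [mul_pow, hs, hw]; norm_num) (by norm_num)
      (by simp [h1, D.cs, D.cw])
      (by simp [h2, D.ts, D.tw]) (by simp [h3, D.σs, D.σw])
  · exact key D.i (-1) (by push_cast; exact hi) (by norm_num) (by simp [h1, D.ci])
      (by simp [h2, D.ti]) (by simp [h3, D.σi])
  · exact key (D.i * D.w) 7 (by push_cast; rw [mul_pow, hi, hw]; norm_num) (by norm_num)
      (by simp [h1, D.ci, D.cw])
      (by simp [h2, D.ti, D.tw]) (by simp [h3, D.σi, D.σw])
  · exact key (D.i * D.s) (-2) (by push_cast; rw [mul_pow, hi, hs]; norm_num) (by norm_num)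
      (by simp [h1, D.ci, D.cs])
      (by simp [h2, D.ti, D.ts]) (by simp [h3, D.σi, D.σs])
  · exact key (D.i * D.s * D.w) 14 (by push_cast; rw [mul_pow, mul_pow, hi, hs, hw]; norm_num)
      (by norm_num) (by simp [h1, D.ci, D.cs, D.cw])
      (by simp [h2, D.ti, D.ts, D.tw]) (by simp [h3, D.σi, D.σs, D.σw])

theorem FQ_sq_of (a b : K) (ha : a ≠ 0) (h1 : IsSquare (a * b)) (h2 : IsSquare a) : IsSquare b := by
  have := h1.div h2
  rwa [mul_div_cancel_left₀ _ ha] at this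

theorem FQ_RRR (D : FQD K) (a b c : K)
    (ha : a ^ 2 - 2 * a - 1 = 0 ∨ a ^ 2 + 2 * a - 1 = 0)
    (hb : b ^ 2 - 2 * b - 1 = 0 ∨ b ^ 2 + 2 * b - 1 = 0)
    (hc : c ^ 2 - 2 * c - 1 = 0 ∨ c ^ 2 + 2 * c - 1 = 0)
    (h : IsSquare ((a - 1) * (b - 1) * (c - 1))) : False := by
  have key : ∀ a : K, (a ^ 2 - 2 * a - 1 = 0 ∨ a ^ 2 + 2 * a - 1 = 0) →
      (a - 1) * D.t (a - 1) = 2 ∨ (a - 1) * D.t (a - 1) = -2 := by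
    intro a ha
    rcases D.R_cases a ha with rfl | rfl | rfl | rfl
    · right; simp only [map_sub, map_add, map_neg, map_one, D.ts]; linear_combination -D.hs
    · right; simp only [map_sub, map_add, map_neg, map_one, D.ts]; linear_combination -D.hs
    · left; simp only [map_sub, map_add, map_neg, map_one, D.ts]; linear_combination -D.hs
    · left; simp only [map_sub, map_add, map_neg, map_one, D.ts]; linear_combination -D.hs
  have h8 : (a - 1) * (b - 1) * (c - 1) * D.t ((a - 1) * (b - 1) * (c - 1)) = 8 ∨
      (a - 1) * (b - 1) * (c - 1) * D.t ((a - 1) * (b - 1) * (c - 1)) = -8 := by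
    have e : (a - 1) * (b - 1) * (c - 1) * D.t ((a - 1) * (b - 1) * (c - 1)) =
      ((a - 1) * D.t (a - 1)) * ((b - 1) * D.t (b - 1)) * ((c - 1) * D.t (c - 1)) := by
      rw [map_mul, map_mul]; ring
    rw [e]
    rcases key a ha with h1 | h1 <;> rcases key b hb with h2 | h2 <;>
      rcases key c hc with h3 | h3 <;> rw [h1, h2, h3] <;> norm_num
  rcases h8 with h8 | h8
  · exact FQD.nonsq D.t D.tt _ (2 * D.s) (by rw [h8, mul_pow, D.hs]; norm_num)
      (by simp only [map_mul, map_ofNat, D.ts]; ring) (mul_ne_zero two_ne_zero D.s_ne) h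
  · exact FQD.nonsq D.t D.tt _ (2 * D.i * D.s) (by rw [h8, mul_pow, mul_pow, D.hs, D.hi]; norm_num)
      (by simp only [map_mul, map_ofNat, D.ts, D.ti]; ring) (mul_ne_zero (mul_ne_zero two_ne_zero D.i_ne) D.s_ne) h

theorem FQ_comb (D : FQD K) (x y : K) (h : x ^ 4 + y ^ 4 = 1) (hx : x ≠ 0) (hy : y ≠ 0) :
    (2 * x ^ 4 - 1) ^ 2 = -63 ∨ (32 * x ^ 4 - 1) ^ 2 = -63 ∨ (32 * x ^ 4 - 31) ^ 2 = -63 := by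
  have hi := D.hi
  obtain ⟨z, hz, hz2⟩ := FQ_zeta D
  have hz0 : z ≠ 0 := by rintro rfl; apply D.i_ne; rw [← hz]; ring
  have hx' : D.σ x ≠ 0 := (map_ne_zero D.σ).mpr hx
  have hy' : D.σ y ≠ 0 := (map_ne_zero D.σ).mpr hy
  obtain ⟨g1, h1, a, sg1, sh1, T1⟩ := FQ_types D x y h hx hy
  obtain ⟨g2, h2, b, sg2, sh2, T2⟩ := FQ_types D y x (by linear_combination h) hy hx
  obtain ⟨g3, h3, c, sg3, sh3, T3⟩ := FQ_types D (z * x / y) (1 / y) (by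
    field_simp
    have : z ^ 4 = -1 := by rw [← D.hi, ← hz]; ring
    linear_combination x ^ 4 * this - h) (div_ne_zero (mul_ne_zero hz0 hx) hy) (one_div_ne_zero hy)
  have cls : ∀ τ : K, ∀ P Q : Prop, ((τ = 1 ∨ τ = -1) ∧ P) ∨ (τ ^ 2 = -1 ∧ Q) ∨
      (τ ^ 2 - 2 * τ - 1 = 0 ∨ τ ^ 2 + 2 * τ - 1 = 0) →
      τ ≠ 0 ∧ (IsSquare τ ∨ (τ ^ 2 - 2 * τ - 1 = 0 ∨ τ ^ 2 + 2 * τ - 1 = 0)) := by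
    intro τ P Q hT
    rcases hT with ⟨rfl | rfl, -⟩ | ⟨hT, -⟩ | hT
    · exact ⟨one_ne_zero, Or.inl ⟨1, by ring⟩⟩
    · exact ⟨by norm_num, Or.inl ⟨D.i, by linear_combination -hi⟩⟩
    · refine ⟨by rintro rfl; norm_num at hT, Or.inl ?_⟩
      rw [← hi] at hT
      rcases sq_eq_sq_iff_eq_or_eq_neg.mp hT with rfl | rfl
      · exact ⟨z, by rw [← hz]; ring⟩
      · exact ⟨D.i * z, by linear_combination -z ^ 2 * hi + hz⟩
    · exact ⟨by rintro rfl; norm_num at hT, Or.inr hT⟩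
  obtain ⟨na, ca⟩ := cls a _ _ T1
  obtain ⟨nb, cb⟩ := cls b _ _ T2
  obtain ⟨nc, cc⟩ := cls c _ _ T3
  have s12 : IsSquare (a * b) := by
    refine FQ_sq_of _ (a * b) (mul_ne_zero g1 g2) ?_ ?_
    · have := sg1.mul sg2
      rwa [mul_mul_mul_comm] at this
    · refine ⟨(1 + x ^ 2 + y ^ 2) * D.σ (1 + x ^ 2 + y ^ 2) / 2, ?_⟩
      have e : (1 + x ^ 2 + y ^ 2) ^ 2 = 2 * (1 + x ^ 2) * (1 + y ^ 2) := by
        linear_combination h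
      have e2 := congrArg D.σ e
      simp only [map_mul, map_pow, map_ofNat] at e2
      field_simp
      linear_combination -(D.σ (1 + x ^ 2 + y ^ 2)) ^ 2 * e - 2 * (1 + x ^ 2) * (1 + y ^ 2) * e2
  have e3 : 1 + (1 / y) ^ 2 = (1 + y ^ 2) / y ^ 2 := by field_simp; ring
  have e4 : 1 + (1 / y) ^ 2 - D.i * (z * x / y) ^ 2 = (1 + x ^ 2 + y ^ 2) / y ^ 2 := by
    field_simp
    linear_combination (-D.i * x ^ 2) * hz - x ^ 2 * hi
  have s13 : IsSquare (a * c) := by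
    refine FQ_sq_of _ (a * c) (mul_ne_zero g1 g3) ?_ ?_
    · have := sg1.mul sg3
      rwa [mul_mul_mul_comm] at this
    · refine ⟨(1 + y ^ 2) * D.σ (1 + y ^ 2) / (y * D.σ y), ?_⟩
      rw [e3, map_div₀, map_pow D.σ y]
      field_simp
  have noR : ¬ (a ^ 2 - 2 * a - 1 = 0 ∨ a ^ 2 + 2 * a - 1 = 0) := by
    intro Ra
    have n1 := D.ns_R a Ra
    have Rb := cb.resolve_left (fun hb => n1 (FQ_sq_of b a nb (by rwa [mul_comm]) hb))
    have Rc := cc.resolve_left (fun hc => n1 (FQ_sq_of c a nc (by rwa [mul_comm]) hc))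
    refine FQ_RRR D a b c Ra Rb Rc ?_
    refine FQ_sq_of _ ((a - 1) * (b - 1) * (c - 1)) (mul_ne_zero (mul_ne_zero h1 h2) h3) ?_ ?_
    · have q := sh1.mul sh2
      rw [mul_mul_mul_comm] at q
      have := q.mul sh3
      rwa [mul_mul_mul_comm] at this
    · refine ⟨(1 - D.i) * ((1 + x ^ 2 + y ^ 2) * D.σ (1 + x ^ 2 + y ^ 2)) / (y * D.σ y), ?_⟩
      have e : (1 + y ^ 2 - D.i * x ^ 2) * (1 + x ^ 2 - D.i * y ^ 2) =
          (1 - D.i) * (1 + x ^ 2 + y ^ 2) := by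
        linear_combination (-D.i) * h + x ^ 2 * y ^ 2 * hi
      have e' := congrArg D.σ e
      rw [map_mul, map_mul, map_sub D.σ 1, map_one, D.σi] at e'
      rw [e4, map_div₀, map_pow D.σ y]
      generalize D.σ (1 + x ^ 2 + y ^ 2) = A at *
      generalize D.σ (1 + y ^ 2 - D.i * x ^ 2) = B at *
      generalize D.σ (1 + x ^ 2 - D.i * y ^ 2) = C at *
      field_simp
      linear_combination ((1 + x ^ 2 + y ^ 2) * A * B * C) * e
        + A * (1 - D.i) * (1 + x ^ 2 + y ^ 2) ^ 2 * e'
  have noRb : ¬ (b ^ 2 - 2 * b - 1 = 0 ∨ b ^ 2 + 2 * b - 1 = 0) := by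
    intro Rb
    have sa := ca.resolve_right noR
    exact D.ns_R b Rb (FQ_sq_of a b na s12 sa)
  have U1 : x ^ 4 * D.σ x ^ 4 = 1 ∨ (y ^ 4 * D.σ y ^ 4) ^ 2 = 16 * (x ^ 4 * D.σ x ^ 4) := by
    rcases T1 with ⟨-, T⟩ | ⟨-, T⟩ | T
    · left; linear_combination T
    · right; linear_combination T
    · exact absurd T noR
  have U2 : y ^ 4 * D.σ y ^ 4 = 1 ∨ (x ^ 4 * D.σ x ^ 4) ^ 2 = 16 * (y ^ 4 * D.σ y ^ 4) := by
    rcases T2 with ⟨-, T⟩ | ⟨-, T⟩ | T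
    · left; linear_combination T
    · right; linear_combination T
    · exact absurd T noRb
  have hσ : D.σ x ^ 4 + D.σ y ^ 4 = 1 := by
    have := congrArg D.σ h; simpa using this
  have m3 := FQ_m3 D
  have hy4 : y ^ 4 = 1 - x ^ 4 := by linear_combination h
  have hy4' : D.σ y ^ 4 = 1 - D.σ x ^ 4 := by linear_combination hσ
  have hn0 : y ^ 4 * D.σ y ^ 4 ≠ 0 := mul_ne_zero (pow_ne_zero _ hy) (pow_ne_zero _ hy')
  obtain ⟨m, hm⟩ : ∃ m, m = x ^ 4 * D.σ x ^ 4 := ⟨_, rfl⟩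
  obtain ⟨n, hn⟩ : ∃ n, n = y ^ 4 * D.σ y ^ 4 := ⟨_, rfl⟩
  have hu : (x ^ 4) ^ 2 - (1 + m - n) * x ^ 4 + m = 0 := by
    rw [hm, hn, hy4, hy4']; ring
  rw [← hm, ← hn] at U1 U2
  rw [← hn] at hn0
  generalize x ^ 4 = u at *
  rcases U1 with U1 | U1 <;> rcases U2 with U2 | U2
  · exfalso
    rw [U1, U2] at hu
    exact m3 (2 * u - 1) (by linear_combination 4 * hu)
  · right; right
    have : n = 1 / 16 := by rw [U1] at U2; linear_combination -U2 / 16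
    rw [U1, this] at hu
    linear_combination 1024 * hu
  · right; left
    have : m = 1 / 16 := by rw [U2] at U1; linear_combination -U1 / 16
    rw [U2, this] at hu
    linear_combination 1024 * hu
  · left
    have h4 : n * ((n - 16) * (n ^ 2 + 16 * n + 256)) = 0 := by
      linear_combination (n ^ 2 + 16 * m) * U1 + 256 * U2
    rcases mul_eq_zero.mp ((mul_eq_zero.mp h4).resolve_left hn0) with h5 | h5
    · have n16 : n = 16 := by linear_combination h5
      have m16 : m = 16 := by rw [n16] at U1; linear_combination -U1 / 16
      rw [n16, m16] at hu
      linear_combination 4 * hu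
    · exact absurd (by linear_combination h5 / 64) (m3 ((n + 8) / 8))

end

section
variable {K : Type*} [Field K] [CharZero K]

def FQA : Fin 8 → ℚ := ![0, 1, 1/2, 1/2, 1/32, 1/32, 31/32, 31/32]
def FQB : Fin 8 → ℚ := ![0, 0, -3/2, 3/2, -3/32, 3/32, -3/32, 3/32]
def FQp : Fin 8 → Fin 8 := ![1, 0, 3, 2, 7, 6, 5, 4]

theorem FQ_inj (D : FQD K) (i j : Fin 8)
    (h : (FQA i : K) + FQB i * D.w = FQA j + FQB j * D.w) : i = j := by
  have h2 := congrArg D.σ h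
  simp only [map_add, map_mul, map_ratCast, D.σw] at h2
  have hA : (FQA i : K) = FQA j := by linear_combination (h + h2) / 2
  have hB : (FQB i : K) = FQB j := by
    apply mul_right_cancel₀ D.w_ne
    linear_combination (h - h2) / 2
  have hA' : FQA i = FQA j := by exact_mod_cast hA
  have hB' : FQB i = FQB j := by exact_mod_cast hB
  clear hA hB h h2
  revert i j
  decide +kernel

theorem FQ_mem (D : FQD K) (x y : K) (h : x ^ 4 + y ^ 4 = 1) :
    ∃ i, x ^ 4 = FQA i + FQB i * D.w := by
  by_cases hx : x = 0
  · exact ⟨0, by simp [FQA, FQB, hx]⟩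
  by_cases hy : y = 0
  · exact ⟨1, by simp [FQA, FQB]; rw [hy] at h; linear_combination h⟩
  have e : (-63 : K) = (3 * D.w) ^ 2 := by linear_combination -9 * D.hw
  rcases FQ_comb D x y h hx hy with h1 | h1 | h1 <;> rw [e] at h1 <;>
    rcases sq_eq_sq_iff_eq_or_eq_neg.mp h1 with h2 | h2
  · exact ⟨3, by simp [FQA, FQB]; linear_combination h2 / 2⟩
  · exact ⟨2, by simp [FQA, FQB]; linear_combination h2 / 2⟩
  · exact ⟨5, by simp [FQA, FQB]; linear_combination h2 / 32⟩
  · exact ⟨4, by simp [FQA, FQB]; linear_combination h2 / 32⟩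
  · exact ⟨7, by simp [FQA, FQB]; linear_combination h2 / 32⟩
  · exact ⟨6, by simp [FQA, FQB]; linear_combination h2 / 32⟩

theorem FQ_root (D : FQD K) (i : Fin 8) : ∃ r : K, r ^ 4 = FQA i + FQB i * D.w := by
  obtain ⟨z, hz, -⟩ := FQ_zeta D
  have hz4 : z ^ 4 = -1 := by rw [← D.hi, ← hz]; ring
  have hw := D.hw
  have hw3 : D.w ^ 3 = -7 * D.w := by linear_combination D.w * hw
  have hw4 : D.w ^ 4 = 49 := by linear_combination (D.w ^ 2 - 7) * hw
  have a1 : ((1 + D.w) / 2) ^ 4 = (1 - 3 * D.w) / 2 := by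
    linear_combination (1/16) * hw4 + (4/16) * hw3 + (6/16) * hw
  have a2 : ((1 - D.w) / 2) ^ 4 = (1 + 3 * D.w) / 2 := by
    linear_combination (1/16) * hw4 - (4/16) * hw3 + (6/16) * hw
  fin_cases i
  · exact ⟨0, by simp [FQA, FQB]⟩
  · exact ⟨1, by simp [FQA, FQB]⟩
  · exact ⟨(1 + D.w) / 2, by simp [FQA, FQB]; linear_combination a1⟩
  · exact ⟨(1 - D.w) / 2, by simp [FQA, FQB]; linear_combination a2⟩
  · exact ⟨(1 + D.w) / 2 / 2, by simp [FQA, FQB]; linear_combination a1 / 16⟩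
  · exact ⟨(1 - D.w) / 2 / 2, by simp [FQA, FQB]; linear_combination a2 / 16⟩
  · refine ⟨z * ((1 - D.w) / 2) ^ 2 / 2, ?_⟩
    have : (z * ((1 - D.w) / 2) ^ 2 / 2) ^ 4 = z ^ 4 * (((1 - D.w) / 2) ^ 4) ^ 2 / 16 := by ring
    rw [this, hz4, a2]
    simp [FQA, FQB]; linear_combination (-9/64) * hw
  · refine ⟨z * ((1 + D.w) / 2) ^ 2 / 2, ?_⟩
    have : (z * ((1 + D.w) / 2) ^ 2 / 2) ^ 4 = z ^ 4 * (((1 + D.w) / 2) ^ 4) ^ 2 / 16 := by ring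
    rw [this, hz4, a1]
    simp [FQA, FQB]; linear_combination (-9/64) * hw

open scoped Classical in
theorem FQ_roots (D : FQD K) (r : K) :
    ∃ s : Finset K, (∀ x, x ∈ s ↔ x ^ 4 = r ^ 4) ∧ s.card = if r = 0 then 1 else 4 := by
  have hi := D.hi
  split_ifs with h
  · refine ⟨{0}, ?_, by simp⟩
    intro x; simp [h]
  · refine ⟨{r, -r, D.i * r, -(D.i * r)}, ?_, ?_⟩
    · intro x
      simp only [Finset.mem_insert, Finset.mem_singleton]
      have : x ^ 4 = r ^ 4 ↔ (x - r) * ((x + r) * ((x - D.i * r) * (x + D.i * r))) = 0 := by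
        have : (x - r) * ((x + r) * ((x - D.i * r) * (x + D.i * r))) = x ^ 4 - r ^ 4 := by
          linear_combination (-(x ^ 2 - r ^ 2) * r ^ 2) * hi
        rw [this, sub_eq_zero]
      rw [this]
      simp only [mul_eq_zero, sub_eq_zero, add_eq_zero_iff_eq_neg]
    · have h1 : D.i ≠ 1 := by
        intro h; rw [h] at hi; norm_num at hi
      have h2 : D.i ≠ -1 := by
        intro h; rw [h] at hi; norm_num at hi
      have n1 : r ≠ -r := fun h0 => h (self_eq_neg.mp h0)
      have n2 : r ≠ D.i * r := fun h0 => h1 (mul_right_cancel₀ h (by linear_combination -h0))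
      have n3 : r ≠ -(D.i * r) := fun h0 => h2 (mul_right_cancel₀ h (by linear_combination h0))
      have n4 : D.i * r ≠ -(D.i * r) := fun h0 => mul_ne_zero D.i_ne h (self_eq_neg.mp h0)
      have n5 : -r ≠ D.i * r := fun h0 => n3 (by rw [← h0, neg_neg])
      have n6 : -r ≠ -(D.i * r) := fun h0 => n2 (neg_injective h0)
      rw [Finset.card_insert_of_notMem (by simp only [Finset.mem_insert, Finset.mem_singleton]; tauto),
        Finset.card_insert_of_notMem (by simp only [Finset.mem_insert, Finset.mem_singleton]; tauto),
        Finset.card_insert_of_notMem (by simp only [Finset.mem_singleton]; tauto),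
        Finset.card_singleton]

open scoped Classical in
theorem FQ_count (D : FQD K) : {p : K × K | p.1 ^ 4 + p.2 ^ 4 = 1}.ncard = 104 := by
  choose r hr using FQ_root D
  choose F hF hc using FQ_roots D
  have hS : {p : K × K | p.1 ^ 4 + p.2 ^ 4 = 1} =
      ((Finset.univ : Finset (Fin 8)).biUnion (fun i => F (r i) ×ˢ F (r (FQp i))) : Finset (K × K)) := by
    have hAB : ∀ i, FQA i + FQA (FQp i) = 1 ∧ FQB i + FQB (FQp i) = 0 := by
      decide +kernel
    have hAB' : ∀ i, (FQA i : K) + FQB i * D.w + (FQA (FQp i) + FQB (FQp i) * D.w) = 1 := by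
      intro i
      have h1 : (FQA i : K) + FQA (FQp i) = 1 := by exact_mod_cast (hAB i).1
      have h2 : (FQB i : K) + FQB (FQp i) = 0 := by exact_mod_cast (hAB i).2
      linear_combination h1 + D.w * h2
    ext ⟨x, y⟩
    simp only [Set.mem_setOf_eq, Finset.coe_biUnion, Set.mem_iUnion, Finset.mem_coe,
      Finset.mem_product, hF, hr, Finset.mem_univ, exists_true_left]
    constructor
    · intro h
      obtain ⟨i, hi⟩ := FQ_mem D x y h
      exact ⟨i, hi, by linear_combination h - hi - hAB' i⟩
    · rintro ⟨i, h1, h2⟩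
      rw [h1, h2, hAB' i]
  rw [hS, Set.ncard_coe_finset, Finset.card_biUnion]
  · have hr0 : ∀ i, r i = 0 ↔ i = 0 := by
      intro i
      rw [← pow_eq_zero_iff (n := 4) (by norm_num), hr]
      constructor
      · intro h
        exact FQ_inj D i 0 (by rw [h]; simp [FQA, FQB])
      · rintro rfl; simp [FQA, FQB]
    simp only [Finset.card_product, hc, hr0]
    simp [Fin.sum_univ_eight, FQp]
  · intro i _ j _ hij
    change Disjoint _ _
    rw [Finset.disjoint_left]
    rintro ⟨x, y⟩ h1 h2
    simp only [Finset.mem_product, hF, hr] at h1 h2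
    exact hij (FQ_inj D i j (h1.1.symm.trans h2.1))

end

section

theorem FQ_re1 {F : Type*} [CommRing F] (d : F) : (1 : QuadraticAlgebra F d 0).re = 1 := rfl
theorem FQ_im1 {F : Type*} [CommRing F] (d : F) : (1 : QuadraticAlgebra F d 0).im = 0 := rfl
theorem FQ_reN {F : Type*} [CommRing F] (d : F) (n : ℕ) [n.AtLeastTwo] :
    (ofNat(n) : QuadraticAlgebra F d 0).re = ofNat(n) := rfl
theorem FQ_imN {F : Type*} [CommRing F] (d : F) (n : ℕ) [n.AtLeastTwo] :
    (ofNat(n) : QuadraticAlgebra F d 0).im = 0 := rfl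

/-- Conjugation on a quadratic algebra. -/
def FQconj {F : Type*} [CommRing F] (d : F) : QuadraticAlgebra F d 0 →+* QuadraticAlgebra F d 0 where
  toFun z := ⟨z.re, -z.im⟩
  map_one' := by ext <;> simp [FQ_re1, FQ_im1, FQ_reN, FQ_imN]
  map_zero' := by ext <;> simp [FQ_re1, FQ_im1, FQ_reN, FQ_imN]
  map_mul' z w := by ext <;> simp [FQ_re1, FQ_im1, FQ_reN, FQ_imN] <;> ring
  map_add' z w := by ext <;> simp [FQ_re1, FQ_im1, FQ_reN, FQ_imN]; ring

/-- Coordinatewise extension of an endomorphism fixing `d`. -/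
def FQext {F : Type*} [CommRing F] (d : F) (f : F →+* F) (hf : f d = d) :
    QuadraticAlgebra F d 0 →+* QuadraticAlgebra F d 0 where
  toFun z := ⟨f z.re, f z.im⟩
  map_one' := by ext <;> simp [FQ_re1, FQ_im1, FQ_reN, FQ_imN]
  map_zero' := by ext <;> simp [FQ_re1, FQ_im1, FQ_reN, FQ_imN]
  map_mul' z w := by ext <;> simp [FQ_re1, FQ_im1, FQ_reN, FQ_imN, hf]
  map_add' z w := by ext <;> simp [FQ_re1, FQ_im1, FQ_reN, FQ_imN]

/-- Evaluation of a quadratic algebra. -/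
def FQev {F L : Type*} [CommRing F] [CommRing L] (d : F) (f : F →+* L) (e : L) (he : e ^ 2 = f d) :
    QuadraticAlgebra F d 0 →+* L where
  toFun z := f z.re + f z.im * e
  map_one' := by simp [FQ_re1, FQ_im1]
  map_zero' := by simp
  map_mul' z w := by simp; linear_combination (-f z.im * f w.im) * he
  map_add' z w := by simp; ring

theorem FQ_qsq {F : Type*} [Field F] [CharZero F] (d q : F) (r : QuadraticAlgebra F d 0)
    (h : r ^ 2 = ⟨q, 0⟩) : ∃ a : F, a ^ 2 = q ∨ d * a ^ 2 = q := by
  rw [pow_two, QuadraticAlgebra.ext_iff] at h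
  simp at h
  obtain ⟨h1, h2⟩ := h
  have h3 : r.re * r.im = 0 := by linear_combination h2 / 2
  rcases mul_eq_zero.mp h3 with h4 | h4
  · exact ⟨r.im, Or.inr (by rw [h4] at h1; linear_combination h1)⟩
  · exact ⟨r.re, Or.inl (by rw [h4] at h1; linear_combination h1)⟩

theorem FQ_cz {F : Type*} [Field F] [CharZero F] (d : F) [Fact (∀ r : F, r ^ 2 ≠ d + 0 * r)] :
    CharZero (QuadraticAlgebra F d 0) :=
  charZero_of_injective_algebraMap (FaithfulSMul.algebraMap_injective F _)

instance FQf1 : Fact (∀ r : ℚ, r ^ 2 ≠ (-1 : ℚ) + 0 * r) := ⟨fun r h => by nlinarith [sq_nonneg r]⟩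

abbrev FQK1 := QuadraticAlgebra ℚ (-1) 0

instance FQc1 : CharZero FQK1 := FQ_cz _

theorem FQ_K1 (q : ℚ) (h1 : ¬ IsSquare q) (h2 : ¬ IsSquare (-q)) (r : FQK1) (h : r ^ 2 = ⟨q, 0⟩) :
    False := by
  obtain ⟨a, ha | ha⟩ := FQ_qsq _ _ r h
  · exact h1 ⟨a, by rw [← ha]; ring⟩
  · exact h2 ⟨a, by rw [← ha]; ring⟩

instance FQf2 : Fact (∀ r : FQK1, r ^ 2 ≠ (2 : FQK1) + 0 * r) := ⟨fun r h => by
  refine FQ_K1 2 (by norm_num) (by norm_num) r ?_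
  rw [h]; ext <;> simp [FQ_re1, FQ_im1, FQ_reN, FQ_imN]⟩

abbrev FQK2 := QuadraticAlgebra FQK1 2 0

instance FQc2 : CharZero FQK2 := FQ_cz _

instance FQf3 : Fact (∀ r : FQK2, r ^ 2 ≠ (-7 : FQK2) + 0 * r) := ⟨fun r h => by
  have h' : r ^ 2 = ⟨-7, 0⟩ := by rw [h]; ext <;> simp [FQ_re1, FQ_im1, FQ_reN, FQ_imN]
  obtain ⟨a, ha | ha⟩ := FQ_qsq _ _ r h'
  · refine FQ_K1 (-7) (by norm_num) (by norm_num) a ?_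
    rw [ha]; ext <;> simp [FQ_re1, FQ_im1, FQ_reN, FQ_imN]
  · refine FQ_K1 (-7/2) (by norm_num) (by norm_num) a ?_
    have : a ^ 2 = -7 / 2 := by linear_combination ha / 2
    have h3 : (2 : FQK1) * ⟨-7/2, 0⟩ = -7 := by
      ext <;> norm_num [FQ_re1, FQ_im1, FQ_reN, FQ_imN]
    rw [this]; linear_combination -h3 / 2⟩

abbrev FQK3 := QuadraticAlgebra FQK2 (-7) 0

instance FQc3 : CharZero FQK3 := FQ_cz _

noncomputable def FQD3 : FQD FQK3 where
  i := ⟨⟨⟨0, 1⟩, 0⟩, 0⟩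
  s := ⟨⟨0, 1⟩, 0⟩
  w := ⟨0, 1⟩
  c := FQext _ (FQext _ (FQconj _) (map_ofNat _ 2)) (by rw [map_neg, map_ofNat])
  t := FQext _ (FQconj _) (by rw [map_neg, map_ofNat])
  σ := FQconj _
  hi := by rw [pow_two]; ext <;> simp [FQ_re1, FQ_im1, FQ_reN, FQ_imN]
  hs := by rw [pow_two]; ext <;> simp [FQ_re1, FQ_im1, FQ_reN, FQ_imN]
  hw := by rw [pow_two]; ext <;> simp [FQ_re1, FQ_im1, FQ_reN, FQ_imN]
  ci := by ext <;> simp [FQ_re1, FQ_im1, FQ_reN, FQ_imN, FQext, FQconj]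
  cs := by ext <;> simp [FQ_re1, FQ_im1, FQ_reN, FQ_imN, FQext, FQconj]
  cw := by ext <;> simp [FQ_re1, FQ_im1, FQ_reN, FQ_imN, FQext, FQconj]
  ti := by ext <;> simp [FQ_re1, FQ_im1, FQ_reN, FQ_imN, FQext, FQconj]
  ts := by ext <;> simp [FQ_re1, FQ_im1, FQ_reN, FQ_imN, FQext, FQconj]
  tw := by ext <;> simp [FQ_re1, FQ_im1, FQ_reN, FQ_imN, FQext, FQconj]
  σi := by ext <;> simp [FQ_re1, FQ_im1, FQ_reN, FQ_imN, FQext, FQconj]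
  σs := by ext <;> simp [FQ_re1, FQ_im1, FQ_reN, FQ_imN, FQext, FQconj]
  σw := by ext <;> simp [FQ_re1, FQ_im1, FQ_reN, FQ_imN, FQext, FQconj]
  cc z := by ext <;> simp [FQ_re1, FQ_im1, FQ_reN, FQ_imN, FQext, FQconj]
  tt z := by ext <;> simp [FQ_re1, FQ_im1, FQ_reN, FQ_imN, FQext, FQconj]
  σσ z := by ext <;> simp [FQ_re1, FQ_im1, FQ_reN, FQ_imN, FQext, FQconj]
  ct z := by ext <;> simp [FQ_re1, FQ_im1, FQ_reN, FQ_imN, FQext, FQconj]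
  cσ z := by ext <;> simp [FQ_re1, FQ_im1, FQ_reN, FQ_imN, FQext, FQconj]
  tσ z := by ext <;> simp [FQ_re1, FQ_im1, FQ_reN, FQ_imN, FQext, FQconj]
  rat z h1 h2 h3 := by
    have a1 : z.im = 0 := self_eq_neg.mp (congrArg QuadraticAlgebra.im h3).symm
    have a2 : z.re.im = 0 := self_eq_neg.mp
      (congrArg (fun z : FQK3 => z.re.im) h2).symm
    have a3 : z.re.re.im = 0 := self_eq_neg.mp
      (congrArg (fun z : FQK3 => z.re.re.im) h1).symm
    refine ⟨z.re.re.re, ?_⟩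
    ext
    · rfl
    · exact a3
    · exact congrArg QuadraticAlgebra.re a2
    · exact congrArg QuadraticAlgebra.im a2
    · rw [a1]; rfl
    · rw [a1]; rfl
    · rw [a1]; rfl
    · rw [a1]; rfl

noncomputable def FQphi : FQK3 →+* ℂ :=
  FQev _ (FQev _ (FQev _ (Rat.castHom ℂ) I (by simp)) (Real.sqrt 2 : ℂ) (by
    rw [map_ofNat]; norm_cast; exact Real.sq_sqrt (by norm_num))) (I * (Real.sqrt 7 : ℂ)) (by
    rw [map_neg, map_ofNat, mul_pow, I_sq]; norm_cast; rw [Real.sq_sqrt (by norm_num)]; norm_num)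

theorem FQphi_i : FQphi FQD3.i = I := by
  simp [FQphi, FQD3, FQev]

theorem FQphi_s : FQphi FQD3.s = (Real.sqrt 2 : ℂ) := by
  simp [FQphi, FQD3, FQev, FQ_re1, FQ_im1]

theorem FQphi_w : FQphi FQD3.w = I * (Real.sqrt 7 : ℂ) := by
  simp [FQphi, FQD3, FQev, FQ_re1, FQ_im1]

theorem FQ_exp : Complex.exp (2 * π * I / 8) = (1 + I) * (Real.sqrt 2 : ℂ) / 2 := by
  have : (2 * π * I / 8 : ℂ) = ((π / 4 : ℝ) : ℂ) * I := by push_cast; ring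
  rw [this, Complex.exp_mul_I, ← Complex.ofReal_cos, ← Complex.ofReal_sin, Real.cos_pi_div_four,
    Real.sin_pi_div_four]
  push_cast; ring

end

theorem FQ_main (K₃ : IntermediateField ℚ ℂ) (hK : K₃ = IntermediateField.adjoin ℚ
    {Complex.exp (2 * π * I / 8), I * (Real.sqrt 7 : ℂ)}) :
    {p : K₃ × K₃ | p.1 ^ 4 + p.2 ^ 4 = 1}.ncard = 104 := by
  have hs2 : ((Real.sqrt 2 : ℝ) : ℂ) ^ 2 = 2 := by
    norm_cast; exact Real.sq_sqrt (by norm_num)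
  have hz : Complex.exp (2 * π * I / 8) ∈ K₃ := by
    rw [hK]; exact IntermediateField.subset_adjoin _ _ (by simp)
  have hw : I * (Real.sqrt 7 : ℂ) ∈ K₃ := by
    rw [hK]; exact IntermediateField.subset_adjoin _ _ (by simp)
  rw [FQ_exp] at hz
  have hI : I ∈ K₃ := by
    have := pow_mem hz 2
    convert this using 1
    linear_combination (-(1 + I) ^ 2 / 4) * hs2 - I_sq / 2
  have hs : (Real.sqrt 2 : ℂ) ∈ K₃ := by
    have := mul_mem hz (sub_mem (one_mem K₃) hI)
    convert this using 1
    linear_combination ((Real.sqrt 2 : ℂ) / 2) * I_sq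
  have hmem : ∀ z, FQphi z ∈ K₃ := by
    intro z
    have hq : ∀ q : ℚ, (q : ℂ) ∈ K₃ := fun q => K₃.algebraMap_mem q
    have h1 : ∀ z : FQK1, (z.re : ℂ) + z.im * I ∈ K₃ := fun z =>
      add_mem (hq _) (mul_mem (hq _) hI)
    have h2 : ∀ z : FQK2, ((z.re.re : ℂ) + z.re.im * I) + (z.im.re + z.im.im * I) * Real.sqrt 2 ∈ K₃ :=
      fun z => add_mem (h1 _) (mul_mem (h1 _) hs)
    exact add_mem (h2 z.re) (mul_mem (h2 z.im) hw)
  have hsurj : ∀ z ∈ K₃, ∃ a, FQphi a = z := by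
    have : K₃ ≤ FQphi.toRatAlgHom.fieldRange := by
      rw [hK, IntermediateField.adjoin_le_iff]
      rintro z (rfl | rfl)
      · refine ⟨(1 + FQD3.i) * FQD3.s / 2, ?_⟩
        change FQphi _ = _
        rw [FQ_exp, map_div₀, map_mul, map_add, map_one, FQphi_i, FQphi_s, map_ofNat]
      · exact ⟨FQD3.w, FQphi_w⟩
    intro z hz
    exact this hz
  have hinj : Function.Injective FQphi := FQphi.injective
  rw [← FQ_count FQD3]
  rw [← Set.ncard_image_of_injective (f := Prod.map FQphi FQphi) _ (hinj.prodMap hinj)]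
  rw [← Set.ncard_image_of_injective (f := Prod.map (Subtype.val : K₃ → ℂ) (Subtype.val : K₃ → ℂ)) _
    (Subtype.val_injective.prodMap Subtype.val_injective)]
  congr 1
  ext ⟨x, y⟩
  simp only [Set.mem_image, Set.mem_setOf_eq, Prod.exists, Prod.map_apply, Prod.mk.injEq]
  constructor
  · rintro ⟨a, b, h, rfl, rfl⟩
    obtain ⟨u, hu⟩ := hsurj _ a.2
    obtain ⟨v, hv⟩ := hsurj _ b.2
    refine ⟨u, v, hinj ?_, hu, hv⟩
    rw [map_add, map_pow, map_pow, hu, hv, map_one]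
    exact congrArg Subtype.val h
  · rintro ⟨a, b, h, rfl, rfl⟩
    refine ⟨⟨_, hmem a⟩, ⟨_, hmem b⟩, Subtype.ext ?_, rfl, rfl⟩
    change FQphi a ^ 4 + FQphi b ^ 4 = 1
    rw [← map_pow, ← map_pow, ← map_add, h, map_one]

/-- Let `K₃ = ℚ(√−7, ζ₈)` be the subfield of `ℂ` generated over `ℚ` by
`ζ₈ = exp(2πi/8)` and `√−7 = i·√7`. Then the Fermat quartic `x⁴ + y⁴ = 1`
has exactly 104 affine points with coordinates in `K₃`. -/
theorem fermat_quartic_affine_points_sqrt_neg_seven_zeta_eight :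
    letI K₃ : IntermediateField ℚ ℂ :=
      IntermediateField.adjoin ℚ
        {Complex.exp (2 * π * I / 8), I * (Real.sqrt 7 : ℂ)}
    {p : K₃ × K₃ | p.1 ^ 4 + p.2 ^ 4 = 1}.ncard = 104 := by
  exact FQ_main _ rfl
end

section
/- For each c ∈ {4, −4, 16, −16}, the Mordell–Weil group over ℚ of the elliptic curve with Weierstrass equation y² = x³ + c·x is a finite abelian group whose order is a power of 2: the group of rational points of the Weierstrass curve over ℚ with coefficients a₁ = a₂ = a₃ = a₆ = 0, a₄ = c is finite, and its cardinality is 2ⁿ for some natural number n. -/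
theorem sq_aux {m n w : ℤ} (h : IsCoprime m n) (hm : 0 < m) (hw : w ≠ 0) (e : m * n = w ^ 2) :
    ∃ x y : ℤ, m = x ^ 2 ∧ n = y ^ 2 ∧ x ≠ 0 ∧ y ≠ 0 := by
  have hn : 0 < n := by
    have : 0 < m * n := by rw [e]; positivity
    exact pos_of_mul_pos_right this hm.le
  obtain ⟨x, hx⟩ := Int.sq_of_gcd_eq_one (Int.isCoprime_iff_gcd_eq_one.mp h) e
  obtain ⟨y, hy⟩ := Int.sq_of_gcd_eq_one (Int.isCoprime_iff_gcd_eq_one.mp h.symm) (by rw [mul_comm]; exact e)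
  have hx' : m = x ^ 2 := by
    rcases hx with hx | hx
    · exact hx
    · nlinarith [sq_nonneg x]
  have hy' : n = y ^ 2 := by
    rcases hy with hy | hy
    · exact hy
    · nlinarith [sq_nonneg y]
  refine ⟨x, y, hx', hy', ?_, ?_⟩
  · rintro rfl; simp at hx'; omega
  · rintro rfl; simp at hy'; omega

theorem descent_step {s r a : ℤ} (ha : 0 < a) (hs : s % 2 = 1) (hr : r ≠ 0) (h : IsCoprime s r)
    (e : s ^ 4 + 4 * r ^ 4 = a ^ 2) :
    ∃ s' r' a' : ℤ, 0 < a' ∧ a' < a ∧ s' ≠ 0 ∧ r' ≠ 0 ∧ s' ^ 4 + 4 * r' ^ 4 = a' ^ 2 := by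
  have h2 : IsCoprime s 2 := by
    refine ⟨1, -(s / 2), ?_⟩
    omega
  have odd_sq : s ^ 2 % 2 = 1 := by
    rw [pow_two, Int.mul_emod, hs]; rfl
  have p1 : PythagoreanTriple (s ^ 2) (2 * r ^ 2) a := by
    unfold PythagoreanTriple; linear_combination e
  have c1 : IsCoprime (s ^ 2) (2 * r ^ 2) := (h2.pow_left).mul_right (h.pow)
  obtain ⟨m, n, e1, e2, e3, g, -, hm⟩ :=
    p1.coprime_classification' (Int.isCoprime_iff_gcd_eq_one.mp c1) odd_sq ha
  have emn : m * n = r ^ 2 := by linarith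
  have hm0 : m ≠ 0 := by
    rintro rfl
    simp at emn; exact hr (by simpa using emn.symm)
  have hmp : 0 < m := by omega
  have gmn := Int.isCoprime_iff_gcd_eq_one.mpr g
  obtain ⟨x, y, hx, hy, hx0, hy0⟩ := sq_aux gmn hmp hr emn
  have cxy : IsCoprime x y := by
    rw [hx, hy] at gmn
    exact (IsCoprime.pow_iff (by norm_num) (by norm_num)).mp gmn
  have p2 : PythagoreanTriple s (y ^ 2) (x ^ 2) := by
    unfold PythagoreanTriple
    rw [hx, hy] at e1; linear_combination e1
  have csy : IsCoprime s (y ^ 2) := by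
    have : IsCoprime (s ^ 2) (y ^ 2) := by
      have h1 : s ^ 2 = x ^ 4 + y ^ 2 * (- y ^ 2) := by rw [e1, hx, hy]; ring
      rw [h1]
      exact IsCoprime.add_mul_left_left (cxy.pow) _
    exact (IsCoprime.pow_left_iff (by norm_num)).mp this
  obtain ⟨p, q, f1, f2, f3, g', par, hp⟩ :=
    p2.coprime_classification' (Int.isCoprime_iff_gcd_eq_one.mp csy) hs (by positivity)
  have gpq := Int.isCoprime_iff_gcd_eq_one.mpr g'
  have hye : Even y := by
    have : Even (y ^ 2) := ⟨p * q, by rw [f2]; ring⟩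
    exact (Int.even_pow.mp this).1
  obtain ⟨w, hw⟩ := hye
  have hw0 : w ≠ 0 := by rintro rfl; simp at hw; exact hy0 hw
  have epq : p * q = 2 * w ^ 2 := by rw [hw] at f2; linarith
  have hp0 : p ≠ 0 := by
    rintro rfl
    simp at epq; exact hw0 epq
  have hpp : 0 < p := by omega
  have hlt : |x| < a := by
    have h1 : |x| ≤ x ^ 2 := by
      rw [← sq_abs]
      have := abs_pos.mpr hx0
      nlinarith
    have h3 : 0 < n := by rw [hy]; positivity
    have : x ^ 2 < a := by rw [← hx, e3]; nlinarith
    omega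
  rcases par with ⟨pe, -⟩ | ⟨-, qe⟩
  · obtain ⟨k, rfl⟩ : (2 : ℤ) ∣ p := Int.dvd_of_emod_eq_zero pe
    obtain ⟨u, v, hu, hv, hu0, hv0⟩ := sq_aux (m := k) (n := q) (w := w)
      gpq.of_mul_left_right (by omega) hw0 (by linarith)
    exact ⟨v, u, |x|, abs_pos.mpr hx0, hlt, hv0, hu0, by rw [sq_abs, f3, hu, hv]; ring⟩
  · obtain ⟨k, rfl⟩ : (2 : ℤ) ∣ q := Int.dvd_of_emod_eq_zero qe
    obtain ⟨u, v, hu, hv, hu0, hv0⟩ := sq_aux (m := p) (n := k) (w := w)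
      gpq.of_mul_right_right hpp hw0 (by linarith)
    exact ⟨u, v, |x|, abs_pos.mpr hx0, hlt, hu0, hv0, by rw [sq_abs, f3, hu, hv]; ring⟩

theorem no_sol_aux : ∀ N : ℕ, ∀ s r a : ℤ, 0 < a → a.toNat = N → s ≠ 0 → r ≠ 0 →
    s ^ 4 + 4 * r ^ 4 = a ^ 2 → False := by
  intro N
  induction N using Nat.strong_induction_on with
  | _ N ih =>
    intro s r a ha hN hs hr e
    have key : ∀ s' r' a' : ℤ, 0 < a' → a' < a → s' ≠ 0 → r' ≠ 0 →
        s' ^ 4 + 4 * r' ^ 4 = a' ^ 2 → False := fun s' r' a' h1 h2 h3 h4 h5 =>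
      ih a'.toNat (by omega) s' r' a' h1 rfl h3 h4 h5
    by_cases hc : IsCoprime s r
    · rcases Int.emod_two_eq_zero_or_one s with h | h
      · obtain ⟨k, rfl⟩ : (2 : ℤ) ∣ s := Int.dvd_of_emod_eq_zero h
        have : Even (a ^ 2) := ⟨8 * k ^ 4 + 2 * r ^ 4, by rw [← e]; ring⟩
        obtain ⟨b, rfl⟩ := (Int.even_pow.mp this).1
        exact key r k b (by omega) (by omega) hr (by rintro rfl; simp at hs)
          (by linarith)
      · obtain ⟨s', r', a', h1, h2, h3, h4, h5⟩ := descent_step ha h hr hc e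
        exact key s' r' a' h1 h2 h3 h4 h5
    · rw [Int.isCoprime_iff_gcd_eq_one] at hc
      obtain ⟨p, hp, hps⟩ := Nat.exists_prime_and_dvd hc
      have h1 : (p : ℤ) ∣ s := (Int.natCast_dvd_natCast.mpr hps).trans (Int.gcd_dvd_left ..)
      have h2 : (p : ℤ) ∣ r := (Int.natCast_dvd_natCast.mpr hps).trans (Int.gcd_dvd_right ..)
      obtain ⟨s', rfl⟩ := h1
      obtain ⟨r', rfl⟩ := h2
      have h3 : ((p : ℤ) ^ 2) ^ 2 ∣ a ^ 2 := ⟨s' ^ 4 + 4 * r' ^ 4, by rw [← e]; ring⟩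
      obtain ⟨b, rfl⟩ := (Int.pow_dvd_pow_iff (by norm_num)).mp h3
      have hp2 : (2 : ℤ) ≤ p := by exact_mod_cast hp.two_le
      have hb : 0 < b := pos_of_mul_pos_right ha (by positivity)
      refine key s' r' b hb ?_ (right_ne_zero_of_mul hs) (right_ne_zero_of_mul hr) ?_
      · have h4 : (4 : ℤ) ≤ (p : ℤ) ^ 2 := by nlinarith
        nlinarith
      · have : ((p : ℤ) ^ 4) ≠ 0 := by positivity
        apply mul_left_cancel₀ this
        linear_combination e

theorem no_sol {s r a : ℤ} (hs : s ≠ 0) (hr : r ≠ 0) : s ^ 4 + 4 * r ^ 4 ≠ a ^ 2 := by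
  intro e
  have ha : a ≠ 0 := by
    rintro rfl
    have : 0 < s ^ 4 + 4 * r ^ 4 := by positivity
    simp at e; omega
  exact no_sol_aux _ s r |a| (abs_pos.mpr ha) rfl hs hr (by rw [sq_abs]; exact e)

theorem rat_gen (k : ℤ) (H : ∀ {s r a : ℤ}, s ≠ 0 → r ≠ 0 → s ^ 4 + k * r ^ 4 ≠ a ^ 2)
    {s r a : ℚ} (hs : s ≠ 0) (hr : r ≠ 0) : s ^ 4 + k * r ^ 4 ≠ a ^ 2 := by
  intro e
  have hsd : (s.den : ℚ) ≠ 0 := by exact_mod_cast s.den_nz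
  have hrd : (r.den : ℚ) ≠ 0 := by exact_mod_cast r.den_nz
  have e1 : s * s.den = s.num := Rat.mul_den_eq_num s
  have e2 : r * r.den = r.num := Rat.mul_den_eq_num r
  have : IsSquare (((s.num * r.den) ^ 4 + k * (r.num * s.den) ^ 4 : ℤ) : ℚ) := by
    refine ⟨a * (s.den * r.den) ^ 2, ?_⟩
    push_cast
    rw [← e1, ← e2]
    linear_combination (s.den * r.den : ℚ) ^ 4 * e
  rw [Rat.isSquare_intCast_iff] at this
  obtain ⟨b, hb⟩ := this
  refine H (s := s.num * r.den) (r := r.num * s.den) (a := b) ?_ ?_ (by rw [hb, pow_two])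
  · exact mul_ne_zero (Rat.num_ne_zero.mpr hs) (by exact_mod_cast r.den_nz)
  · exact mul_ne_zero (Rat.num_ne_zero.mpr hr) (by exact_mod_cast s.den_nz)

theorem rat4 {s r a : ℚ} (hs : s ≠ 0) (hr : r ≠ 0) : s ^ 4 + 4 * r ^ 4 ≠ a ^ 2 := by
  have := rat_gen 4 (fun hs hr => no_sol hs hr) (a := a) hs hr
  simpa using this

theorem rat1 {s r a : ℚ} (hs : s ≠ 0) (hr : r ≠ 0) : s ^ 4 + r ^ 4 ≠ a ^ 2 := by
  have := rat_gen 1 (fun {s r a} hs hr => by rw [one_mul]; exact not_fermat_42 hs hr) (a := a) hs hr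
  simpa using this

theorem dbl {b u v : ℚ} (hv : v ≠ 0) (e : v ^ 2 = u ^ 3 + b * u) :
    ((u ^ 2 - b) / (2 * v)) ^ 4 + b = ((u ^ 4 + 6 * b * u ^ 2 + b ^ 2) / (4 * v ^ 2)) ^ 2 := by
  have e4 : v ^ 4 = (u ^ 3 + b * u) ^ 2 := by rw [← e]; ring
  field_simp
  rw [e4]
  ring

theorem no_sqrt (n : ℕ) (h : ¬ IsSquare n) (x : ℚ) : x ^ 2 ≠ n := by
  intro e
  exact h (Rat.isSquare_natCast_iff.mp ⟨x, by rw [← e, pow_two]⟩)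

theorem curve_neg4 {u v : ℚ} (e : v ^ 2 = u ^ 3 + (-4) * u) : v = 0 := by
  by_contra hv
  have d := dbl hv e
  set t := (u ^ 2 - -4) / (2 * v) with ht
  set s := (u ^ 4 + 6 * -4 * u ^ 2 + (-4) ^ 2) / (4 * v ^ 2)
  have ht0 : t ≠ 0 := by
    have : u ^ 2 - -4 ≠ 0 := by rw [sub_neg_eq_add]; positivity
    rw [ht]; exact div_ne_zero this (mul_ne_zero two_ne_zero hv)
  have hs0 : s ≠ 0 := by
    intro h
    rw [h] at d
    have h1 : (t ^ 2 - 2) * (t ^ 2 + 2) = 0 := by linear_combination d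
    have h2 : t ^ 2 + 2 ≠ 0 := by positivity
    have h3 : t ^ 2 = 2 := by
      have := (mul_eq_zero.mp h1).resolve_right h2
      linarith
    exact no_sqrt 2 (by decide +kernel) t (by exact_mod_cast h3)
  exact rat1 hs0 (mul_ne_zero two_ne_zero ht0) (a := t ^ 4 + 4)
    (by linear_combination (-(s ^ 2) - (t ^ 4 - 4)) * d)

theorem curve_neg16 {u v : ℚ} (e : v ^ 2 = u ^ 3 + (-16) * u) : v = 0 := by
  by_contra hv
  have d := dbl hv e
  set t := (u ^ 2 - -16) / (2 * v) with ht
  set s := (u ^ 4 + 6 * -16 * u ^ 2 + (-16) ^ 2) / (4 * v ^ 2) with hs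
  have ht0 : t ≠ 0 := by
    have : u ^ 2 - -16 ≠ 0 := by rw [sub_neg_eq_add]; positivity
    rw [ht]; exact div_ne_zero this (mul_ne_zero two_ne_zero hv)
  have hs0 : s ≠ 0 := by
    intro h
    rw [hs, div_eq_zero_iff] at h
    have h1 := h.resolve_right (by positivity)
    exact no_sqrt 2048 (by decide +kernel) (u ^ 2 - 48) (by push_cast; linear_combination h1)
  exact rat4 hs0 (mul_ne_zero two_ne_zero ht0) (a := t ^ 4 + 16)
    (by linear_combination (-(s ^ 2) - (t ^ 4 - 16)) * d)

theorem curve_16 {u v : ℚ} (e : v ^ 2 = u ^ 3 + 16 * u) : v = 0 := by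
  by_contra hv
  have d := dbl hv e
  set t := (u ^ 2 - 16) / (2 * v) with ht
  set s := (u ^ 4 + 6 * 16 * u ^ 2 + (16) ^ 2) / (4 * v ^ 2) with hs
  have ht0 : t ≠ 0 := by
    intro h
    rw [ht, div_eq_zero_iff] at h
    have h1 := h.resolve_right (by positivity)
    have h2 : (u - 4) * (u + 4) = 0 := by linear_combination h1
    rcases mul_eq_zero.mp h2 with h3 | h3
    · have : u = 4 := by linarith
      rw [this] at e
      exact no_sqrt 128 (by decide +kernel) v (by rw [e]; norm_num)
    · have : u = -4 := by linarith
      rw [this] at e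
      nlinarith [sq_nonneg v]
  exact rat1 ht0 two_ne_zero (a := s) (by linear_combination d)

theorem curve_4 {u v : ℚ} (e : v ^ 2 = u ^ 3 + 4 * u) : v = 0 ∨ u = 2 := by
  by_contra! H
  obtain ⟨hv, hu⟩ := H
  have d := dbl hv e
  set t := (u ^ 2 - 4) / (2 * v) with ht
  set s := (u ^ 4 + 6 * 4 * u ^ 2 + (4) ^ 2) / (4 * v ^ 2) with hs
  have ht0 : t ≠ 0 := by
    intro h
    rw [ht, div_eq_zero_iff] at h
    have h1 := h.resolve_right (by positivity)
    have h2 : (u - 2) * (u + 2) = 0 := by linear_combination h1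
    rcases mul_eq_zero.mp h2 with h3 | h3
    · exact hu (by linarith)
    · have : u = -2 := by linarith
      rw [this] at e
      nlinarith [sq_nonneg v]
  exact rat4 ht0 one_ne_zero (a := s) (by linear_combination d)

open WeierstrassCurve in
theorem nons {c : ℚ} (hc : c ≠ 0) {x y : ℚ} :
    (({ a₁ := 0, a₂ := 0, a₃ := 0, a₄ := c, a₆ := 0 } : WeierstrassCurve ℚ).toAffine).Nonsingular x y
      ↔ y ^ 2 = x ^ 3 + c * x := by
  rw [← Affine.equation_iff_nonsingular_of_Δ_ne_zero, Affine.equation_iff]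
  · simp
  · simp [WeierstrassCurve.Δ, WeierstrassCurve.b₂, WeierstrassCurve.b₄, WeierstrassCurve.b₆,
      WeierstrassCurve.b₈, hc]

theorem fin_of_bij {α : Type*} (n : ℕ) (f : Fin (2 ^ n) → α) (hf : Function.Bijective f) :
    Finite α ∧ ∃ n : ℕ, Nat.card α = 2 ^ n :=
  ⟨Finite.of_surjective f hf.2, n, by rw [← Nat.card_eq_of_bijective f hf]; simp⟩

/-- For each `c ∈ {4, −4, 16, −16}`, the Mordell–Weil group over `ℚ` of the
elliptic curve `y² = x³ + c·x` is finite of 2-power order. -/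
theorem mordell_weil_twists_finite_two_power
    (c : ℚ) (hc : c ∈ ({4, -4, 16, -16} : Set ℚ))
    (W : WeierstrassCurve ℚ)
    (hW : W = { a₁ := 0, a₂ := 0, a₃ := 0, a₄ := c, a₆ := 0 }) :
    Finite W.toAffine.Point ∧ ∃ n : ℕ, Nat.card W.toAffine.Point = 2 ^ n := by
  subst hW
  have hc0 : c ≠ 0 := by
    rintro rfl
    norm_num at hc
  rcases hc with rfl | rfl | rfl | rfl
  · refine fin_of_bij 2 ![.zero, .some 0 0 ((nons hc0).2 (by norm_num)),
      .some 2 4 ((nons hc0).2 (by norm_num)), .some 2 (-4) ((nons hc0).2 (by norm_num))] ⟨?_, ?_⟩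
    · intro i j hij
      fin_cases i <;> fin_cases j <;> first | rfl | (exfalso; simp at hij; try norm_num at hij)
    · rintro (_ | ⟨x, y, h⟩)
      · exact ⟨0, rfl⟩
      · have e := (nons hc0).1 h
        rcases curve_4 e with rfl | rfl
        · have h1 : x * (x ^ 2 + 4) = 0 := by linear_combination -e
          obtain rfl := (mul_eq_zero.mp h1).resolve_right (by positivity)
          exact ⟨1, rfl⟩
        · have h1 : (y - 4) * (y + 4) = 0 := by linear_combination e
          rcases mul_eq_zero.mp h1 with h3 | h3
          · obtain rfl : y = 4 := by linarith
            exact ⟨2, rfl⟩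
          · obtain rfl : y = -4 := by linarith
            exact ⟨3, rfl⟩
  · refine fin_of_bij 2 ![.zero, .some 0 0 ((nons hc0).2 (by norm_num)),
      .some 2 0 ((nons hc0).2 (by norm_num)), .some (-2) 0 ((nons hc0).2 (by norm_num))] ⟨?_, ?_⟩
    · intro i j hij
      fin_cases i <;> fin_cases j <;> first | rfl | (exfalso; simp at hij; try norm_num at hij)
    · rintro (_ | ⟨x, y, h⟩)
      · exact ⟨0, rfl⟩
      · have e := (nons hc0).1 h
        obtain rfl := curve_neg4 e
        have h1 : x * ((x - 2) * (x + 2)) = 0 := by linear_combination -e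
        rcases mul_eq_zero.mp h1 with rfl | h3
        · exact ⟨1, rfl⟩
        rcases mul_eq_zero.mp h3 with h3 | h3
        · obtain rfl : x = 2 := by linarith
          exact ⟨2, rfl⟩
        · obtain rfl : x = -2 := by linarith
          exact ⟨3, rfl⟩
  · refine fin_of_bij 1 ![.zero, .some 0 0 ((nons hc0).2 (by norm_num))] ⟨?_, ?_⟩
    · intro i j hij
      fin_cases i <;> fin_cases j <;> first | rfl | (exfalso; simp at hij; try norm_num at hij)
    · rintro (_ | ⟨x, y, h⟩)
      · exact ⟨0, rfl⟩
      · have e := (nons hc0).1 h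
        obtain rfl := curve_16 e
        have h1 : x * (x ^ 2 + 16) = 0 := by linear_combination -e
        obtain rfl := (mul_eq_zero.mp h1).resolve_right (by positivity)
        exact ⟨1, rfl⟩
  · refine fin_of_bij 2 ![.zero, .some 0 0 ((nons hc0).2 (by norm_num)),
      .some 4 0 ((nons hc0).2 (by norm_num)), .some (-4) 0 ((nons hc0).2 (by norm_num))] ⟨?_, ?_⟩
    · intro i j hij
      fin_cases i <;> fin_cases j <;> first | rfl | (exfalso; simp at hij; try norm_num at hij)
    · rintro (_ | ⟨x, y, h⟩)
      · exact ⟨0, rfl⟩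
      · have e := (nons hc0).1 h
        obtain rfl := curve_neg16 e
        have h1 : x * ((x - 4) * (x + 4)) = 0 := by linear_combination -e
        rcases mul_eq_zero.mp h1 with rfl | h3
        · exact ⟨1, rfl⟩
        rcases mul_eq_zero.mp h3 with h3 | h3
        · obtain rfl : x = 4 := by linarith
          exact ⟨2, rfl⟩
        · obtain rfl : x = -4 := by linarith
          exact ⟨3, rfl⟩
end
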